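/- arXiv:1711.08332 — 3 statements merged into one kernel-verified Lean document; each statement's English description precedes it below -/
import Mathlib

section
/- Let \beta \ge 0. Let \rho be a smooth, even, compactly supported function on \mathbb{R}^4 with \int_{\mathbb{R}^4}\rho = 1, set \eta(x) = \rho(x) - 2^{-|s|}\rho(2^{-1}\cdot x), and assume there exists \xi_0\in\mathbb{R}^4 such that |\hat{\eta}(\xi_0)| - \sum_{n\in\mathbb{Z}\setminus\{0\}} 2^{-n\beta}|\hat{\eta}(2^{-n}\cdot\xi_0)| > 0. Let (\alpha_n)_{n\ge 0} be a bounded real sequence with \limsup_{n\to\infty} 2^{n\beta}|\alpha_n| \in (0,\infty), and set \hat{R}(\xi) = \alpha_0\hat{\rho}(\xi) + \sum_{n\ge 1}\alpha_n\hat{\eta}(2^{-n}\cdot\xi). Then \limsup_{n\to\infty} 2^{n\beta}\,|\hat{R}(2^n\cdot\xi_0)| > 0. -/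
open MeasureTheory Filter Topology

noncomputable section

/-- Parabolic scaling exponents s = (2,1,1,1). -/
def sExp : Fin 4 → ℕ := ![2, 1, 1, 1]

/-- Parabolically scaled norm |z|_s = max_i |z_i|^(1/s_i). -/
def snorm4 (z : Fin 4 → ℝ) : ℝ := ⨆ i, |z i| ^ ((sExp i : ℝ)⁻¹)

/-- Scaling action l · z = (l^(s_i) z_i)_i. -/
def scl (l : ℝ) (z : Fin 4 → ℝ) : Fin 4 → ℝ := fun i => l ^ (sExp i) * z i

/-- Scaled size |k|_s = ∑ s_i k_i of a multi-index. -/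
def ksize (k : Fin 4 → ℕ) : ℝ := ∑ i, (sExp i : ℝ) * (k i : ℝ)

/-- Partial derivative in direction i. -/
def pderiv1 (i : Fin 4) (f : (Fin 4 → ℝ) → ℝ) : (Fin 4 → ℝ) → ℝ :=
  fun z => fderiv ℝ f z (Pi.single i 1)

/-- Iterated partial derivative ∂^k. -/
def pderivM (k : Fin 4 → ℕ) (f : (Fin 4 → ℝ) → ℝ) : (Fin 4 → ℝ) → ℝ :=
  ((pderiv1 0)^[k 0] ∘ (pderiv1 1)^[k 1] ∘ (pderiv1 2)^[k 2] ∘ (pderiv1 3)^[k 3]) f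

/-- Assumption R from the paper: the R_n are even smooth functions, R_n is supported in a
parabolic ball of radius C₀ 2^(-n), the derivative ∂^k R_n is bounded by
C_k 2^(n(|s| + |k|_s - β)) (with |s| = 5), and if β = 0 then R_n integrates to zero
for n ≥ 1. -/
structure AssumptionR (R : ℕ → (Fin 4 → ℝ) → ℝ) (β : ℝ) : Prop where
  beta_nonneg : 0 ≤ β
  even : ∀ n z, R n (-z) = R n z
  smooth : ∀ n, ContDiff ℝ (⊤ : ℕ∞) (R n)
  support : ∃ C0 > 0, ∀ n z, R n z ≠ 0 → snorm4 z ≤ C0 * (2 : ℝ) ^ (-(n : ℝ))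
  deriv_bound : ∀ k : Fin 4 → ℕ, ∃ Ck > 0, ∀ n z,
    |pderivM k (R n) z| ≤ Ck * (2 : ℝ) ^ ((n : ℝ) * (5 + ksize k - β))
  mean_zero : β = 0 → ∀ n, 1 ≤ n → (∫ z, R n z) = 0

/-- Fourier transform on ℝ⁴ with convention e^(-i⟨ξ,z⟩). -/
def ft (f : (Fin 4 → ℝ) → ℝ) (ξ : Fin 4 → ℝ) : ℂ :=
  ∫ z : Fin 4 → ℝ, Complex.exp (-Complex.I * ((∑ i, ξ i * z i : ℝ) : ℂ)) * (f z : ℂ)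

/-- The parabolic annulus A_n^C. -/
def AnC (C : ℝ) (n : ℕ) : Set (Fin 4 → ℝ) :=
  {ξ | C⁻¹ * 2 ^ n ≤ snorm4 ξ ∧ snorm4 ξ ≤ C * 2 ^ n}

/-- The set B_n^C. -/
def BnC (C : ℝ) (n : ℕ) : Set ((Fin 4 → ℝ) × (Fin 4 → ℝ)) :=
  {p | p.1 ∈ AnC C n ∧ p.2 ∈ AnC C n ∧ p.1 + p.2 ∈ AnC C n}

/-- Integration of a nonnegative function against the measure m̂, given by
(1/2π) ∫ dξ₀ ∑_(k ∈ ℤ³) f(ξ₀, 2πk₁, 2πk₂, 2πk₃). -/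
def mIntegral (f : (Fin 4 → ℝ) → ENNReal) : ENNReal :=
  ENNReal.ofReal (1 / (2 * Real.pi)) *
    ∫⁻ t : ℝ, ∑' k : Fin 3 → ℤ, f (Fin.cons t (fun j => 2 * Real.pi * (k j : ℝ)))

theorem continuous_scl (l : ℝ) : Continuous (scl l) := by
  unfold scl
  fun_prop

theorem scl_scl (a b : ℝ) (z : Fin 4 → ℝ) : scl a (scl b z) = scl (a * b) z := by
  funext i
  simp only [scl, mul_pow, mul_assoc]

theorem scl_one (z : Fin 4 → ℝ) : scl 1 z = z := by
  funext i
  simp [scl]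

theorem one_le_sExp (i : Fin 4) : 1 ≤ sExp i := by
  fin_cases i <;> simp [sExp]

theorem scl_zero_right (l : ℝ) : scl l 0 = 0 := by
  funext i
  simp [scl]

/-- The parabolic dilation by a nonzero factor, as a homeomorphism. -/
def sclHomeomorph (l : ℝ) (hl : l ≠ 0) : (Fin 4 → ℝ) ≃ₜ (Fin 4 → ℝ) where
  toFun := scl l
  invFun := scl l⁻¹
  left_inv z := by rw [scl_scl, inv_mul_cancel₀ hl, scl_one]
  right_inv z := by rw [scl_scl, mul_inv_cancel₀ hl, scl_one]
  continuous_toFun := continuous_scl l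
  continuous_invFun := continuous_scl l⁻¹

theorem integral_comp_scl (f : (Fin 4 → ℝ) → ℝ) {l : ℝ} (hl : 0 < l) :
    l ^ 5 * ∫ z, f (scl l z) = ∫ z, f z := by
  have hdet : (Matrix.diagonal fun i => l ^ sExp i).det = l ^ 5 := by
    rw [Matrix.det_diagonal, Fin.prod_univ_four]
    simp only [sExp, Matrix.cons_val]
    ring
  have key := Real.smul_map_diagonal_volume_pi (D := fun i => l ^ sExp i)
    (by rw [hdet]; positivity)
  have hfun : ⇑(Matrix.toLin' (Matrix.diagonal fun i => l ^ sExp i)) =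
      sclHomeomorph l hl.ne' := by
    funext z i
    simp [sclHomeomorph, scl, Matrix.mulVec_diagonal]
  rw [hdet, abs_of_pos (by positivity), hfun] at key
  conv_rhs => rw [← key]
  rw [integral_smul_measure, (sclHomeomorph l hl.ne').measurableEmbedding.integral_map,
    ENNReal.toReal_ofReal (by positivity), smul_eq_mul]
  rfl

theorem norm_fourier_kernel (x : ℝ) : ‖Complex.exp (-Complex.I * (x : ℂ))‖ = 1 := by
  have h : -Complex.I * (x : ℂ) = ((-x : ℝ) : ℂ) * Complex.I := by push_cast; ring
  rw [h, Complex.norm_exp_ofReal_mul_I]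

theorem norm_ft_le (f : (Fin 4 → ℝ) → ℝ) (ξ : Fin 4 → ℝ) : ‖ft f ξ‖ ≤ ∫ z, |f z| := by
  refine (norm_integral_le_integral_norm _).trans_eq ?_
  refine integral_congr_ae (Eventually.of_forall fun z => ?_)
  simp only [norm_mul, norm_fourier_kernel, one_mul, Complex.norm_real, Real.norm_eq_abs]

theorem ft_pderiv1 {f : (Fin 4 → ℝ) → ℝ} (hf : ContDiff ℝ (⊤ : ℕ∞) f)
    (hfs : HasCompactSupport f) (i : Fin 4) (ξ : Fin 4 → ℝ) :
    ft (pderiv1 i f) ξ = Complex.I * ξ i * ft f ξ := by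
  have hfd : Differentiable ℝ f := hf.differentiable (by simp)
  set e : (Fin 4 → ℝ) → ℂ := fun z =>
    Complex.exp (-Complex.I * ((∑ j, ξ j * z j : ℝ) : ℂ)) with he
  have hec : Continuous e := by rw [he]; fun_prop
  have hF : ∀ z, HasFDerivAt (fun z => (f z : ℂ)) (Complex.ofRealCLM ∘L fderiv ℝ f z) z :=
    fun z => Complex.ofRealCLM.hasFDerivAt.comp z (hfd z).hasFDerivAt
  let P : (Fin 4 → ℝ) →L[ℝ] ℝ := ∑ j, ξ j • ContinuousLinearMap.proj (R := ℝ) (φ := fun _ => ℝ) j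
  have hP : ∀ z, P z = ∑ j, ξ j * z j := fun z => by simp [P]
  have hE : ∀ z, HasFDerivAt e
      (e z • (-Complex.I • (Complex.ofRealCLM ∘L P))) z := by
    intro z
    have h1 : HasFDerivAt (fun z => -Complex.I * ((P z : ℝ) : ℂ))
        (-Complex.I • (Complex.ofRealCLM ∘L P)) z :=
      (Complex.ofRealCLM.hasFDerivAt.comp z P.hasFDerivAt).const_mul (-Complex.I)
    simpa only [he, hP] using h1.cexp
  have hcF : Continuous (fun z => (f z : ℂ)) := by
    have := hf.continuous; fun_prop
  have hsF : HasCompactSupport (fun z => (f z : ℂ)) := hfs.comp_left (g := Complex.ofReal) (by simp)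
  have hcF' : Continuous (fun z => ((pderiv1 i f z : ℝ) : ℂ)) := by
    have : Continuous (pderiv1 i f) := (hf.continuous_fderiv (by simp)).clm_apply continuous_const
    fun_prop
  have hsF' : HasCompactSupport (fun z => ((pderiv1 i f z : ℝ) : ℂ)) :=
    (hfs.fderiv_apply (𝕜 := ℝ) (Pi.single i 1)).comp_left (g := Complex.ofReal) (by simp)
  have hPi : P (Pi.single i 1) = ξ i := by
    rw [hP]; simp [Pi.single_apply]
  have hEi : ∀ z, fderiv ℝ e z (Pi.single i 1) = e z * (-Complex.I * ξ i) := by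
    intro z
    rw [(hE z).fderiv]
    simp [hPi]
  have hFi : ∀ z, fderiv ℝ (fun z => (f z : ℂ)) z (Pi.single i 1) = (pderiv1 i f z : ℂ) := by
    intro z
    rw [(hF z).fderiv]
    simp [pderiv1]
  have h := integral_mul_fderiv_eq_neg_fderiv_mul_of_integrable (μ := volume) (𝕜 := ℂ)
    (f := e) (g := fun z => (f z : ℂ)) (v := (Pi.single i 1 : Fin 4 → ℝ)) ?_ ?_ ?_
    (fun z _ => (hE z).differentiableAt) (fun z _ => (hF z).differentiableAt)
  · simp only [hEi, hFi] at h
    change ∫ z, e z * (pderiv1 i f z : ℂ) = Complex.I * ξ i * ∫ z, e z * (f z : ℂ)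
    rw [h, ← integral_neg, ← integral_const_mul]
    congr 1
    funext z
    ring
  · simp only [hEi]
    exact Continuous.integrable_of_hasCompactSupport (by fun_prop) hsF.mul_left
  · simp only [hFi]
    exact Continuous.integrable_of_hasCompactSupport (by fun_prop) hsF'.mul_left
  · exact Continuous.integrable_of_hasCompactSupport (by fun_prop) hsF.mul_left

theorem exists_pow_mul_norm_ft_le (i : Fin 4) (N : ℕ) {f : (Fin 4 → ℝ) → ℝ}
    (hf : ContDiff ℝ (⊤ : ℕ∞) f) (hfs : HasCompactSupport f) :
    ∃ C, ∀ ξ, |ξ i| ^ N * ‖ft f ξ‖ ≤ C := by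
  induction N generalizing f with
  | zero => exact ⟨_, fun ξ => by simpa using norm_ft_le f ξ⟩
  | succ N ih =>
    obtain ⟨C, hC⟩ := ih (f := pderiv1 i f)
      ((hf.fderiv_right (m := (⊤ : ℕ∞)) (by simp)).clm_apply contDiff_const)
      (hfs.fderiv_apply (𝕜 := ℝ) (Pi.single i 1))
    refine ⟨C, fun ξ => ?_⟩
    have h := hC ξ
    rw [ft_pderiv1 hf hfs] at h
    simpa [pow_succ, mul_assoc] using h

/-- Rapid decay of the Fourier transform of a test function along a parabolic ray. -/
theorem exists_norm_ft_scl_le {f : (Fin 4 → ℝ) → ℝ} (hf : ContDiff ℝ (⊤ : ℕ∞) f)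
    (hfs : HasCompactSupport f) {ξ : Fin 4 → ℝ} (hξ : ξ ≠ 0) (N : ℕ) :
    ∃ C, ∀ l : ℝ, 1 ≤ l → l ^ N * ‖ft f (scl l ξ)‖ ≤ C := by
  obtain ⟨i, hi⟩ := Function.ne_iff.1 hξ
  have hi' : 0 < |ξ i| ^ N := pow_pos (abs_pos.2 hi) N
  obtain ⟨C, hC⟩ := exists_pow_mul_norm_ft_le i N hf hfs
  refine ⟨C / |ξ i| ^ N, fun l hl => ?_⟩
  rw [le_div_iff₀ hi']
  refine le_trans ?_ (hC (scl l ξ))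
  have h1 : l * |ξ i| ≤ |scl l ξ i| := by
    rw [scl, abs_mul, abs_pow, abs_of_nonneg (zero_le_one.trans hl)]
    gcongr
    exact le_self_pow₀ hl (Nat.one_le_iff_ne_zero.1 (one_le_sExp i))
  calc l ^ N * ‖ft f (scl l ξ)‖ * |ξ i| ^ N = (l * |ξ i|) ^ N * ‖ft f (scl l ξ)‖ := by ring
    _ ≤ _ := by gcongr

/-- The Fourier transform of a mean-zero test function vanishes linearly at the origin along a
parabolic ray. -/
theorem exists_norm_ft_scl_le_of_integral_eq_zero {f : (Fin 4 → ℝ) → ℝ} (hf : Continuous f)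
    (hfs : HasCompactSupport f) (hf0 : ∫ z, f z = 0) (ξ : Fin 4 → ℝ) :
    ∃ C, ∀ l : ℝ, 0 ≤ l → l ≤ 1 → ‖ft f (scl l ξ)‖ ≤ C * l := by
  refine ⟨∫ z, (∑ i, |ξ i| * |z i|) * |f z|, fun l hl0 hl1 => ?_⟩
  have hfc : Integrable (fun z => (f z : ℂ)) := (hf.integrable_of_hasCompactSupport hfs).ofReal
  have h1 : ft f (scl l ξ) =
      ∫ z, (Complex.exp (-Complex.I * ((∑ i, scl l ξ i * z i : ℝ) : ℂ)) - 1) * (f z : ℂ) := by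
    simp only [sub_mul, one_mul]
    rw [integral_sub _ hfc, integral_complex_ofReal, hf0, Complex.ofReal_zero, sub_zero]
    · rfl
    · refine Continuous.integrable_of_hasCompactSupport (by fun_prop) ?_
      exact (hfs.comp_left (g := Complex.ofReal) (by simp)).mul_left
  rw [h1, mul_comm, ← integral_const_mul]
  refine norm_integral_le_of_norm_le ?_ (Eventually.of_forall fun z => ?_)
  · refine (Continuous.integrable_of_hasCompactSupport (by fun_prop) ?_).const_mul l
    exact (hfs.comp_left (g := fun x : ℝ => |x|) (by simp)).mul_left
  · rw [norm_mul, Complex.norm_real, Real.norm_eq_abs, ← mul_assoc]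
    gcongr
    have h2 := Real.norm_exp_I_mul_ofReal_sub_one_le (x := -∑ i, scl l ξ i * z i)
    rw [show -Complex.I * ((∑ i, scl l ξ i * z i : ℝ) : ℂ) =
      Complex.I * ((-∑ i, scl l ξ i * z i : ℝ) : ℂ) by push_cast; ring]
    refine h2.trans ?_
    rw [norm_neg, Finset.mul_sum]
    refine (norm_sum_le _ _).trans (Finset.sum_le_sum fun i _ => ?_)
    rw [norm_mul, Real.norm_eq_abs, Real.norm_eq_abs, scl, abs_mul, abs_pow, abs_of_nonneg hl0,
      ← mul_assoc]
    gcongr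
    exact pow_le_of_le_one hl0 hl1 (Nat.one_le_iff_ne_zero.1 (one_le_sExp i))

theorem rpow_mul_le_of_pow_mul_le {β : ℝ} {N : ℕ} (hN : β + 1 ≤ N) (n : ℕ) {x C : ℝ}
    (hx : 0 ≤ x) (h : ((2 : ℝ) ^ n) ^ N * x ≤ C) :
    (2 : ℝ) ^ ((n : ℝ) * β) * x ≤ C * 2⁻¹ ^ n := by
  have h2 : (2 : ℝ) ^ ((n : ℝ) * β) * 2 ^ n ≤ (2 ^ n) ^ N := by
    rw [← Real.rpow_natCast 2 n, ← Real.rpow_add (by norm_num), ← Real.rpow_natCast (2 ^ (n : ℝ)),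
      ← Real.rpow_mul (by norm_num)]
    exact Real.rpow_le_rpow_of_exponent_le (by norm_num) (by nlinarith [n.cast_nonneg (α := ℝ)])
  rw [inv_pow, ← div_eq_mul_inv, le_div_iff₀ (by positivity)]
  calc (2 : ℝ) ^ ((n : ℝ) * β) * x * 2 ^ n = (2 : ℝ) ^ ((n : ℝ) * β) * 2 ^ n * x := by ring
    _ ≤ (2 ^ n) ^ N * x := by gcongr
    _ ≤ C := h

/-- The weights `2^{-nβ} |f̂(2^{-n} · ξ)|` are summable over `n ∈ ℤ` for a mean-zero test
function `f`. -/
theorem summable_rpow_mul_norm_ft_scl {β : ℝ} (hβ : 0 ≤ β) {f : (Fin 4 → ℝ) → ℝ}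
    (hf : ContDiff ℝ (⊤ : ℕ∞) f) (hfs : HasCompactSupport f) (hf0 : ∫ z, f z = 0)
    {ξ : Fin 4 → ℝ} (hξ : ξ ≠ 0) :
    Summable fun n : ℤ =>
      (2 : ℝ) ^ (-(n : ℝ) * β) * ‖ft f (scl ((2 : ℝ) ^ (-(n : ℝ))) ξ)‖ := by
  have hgeo (C : ℝ) : Summable fun n : ℕ => C * (2⁻¹ : ℝ) ^ n :=
    (summable_geometric_of_lt_one (by norm_num) (by norm_num)).mul_left C
  have hpow (n : ℕ) : (2 : ℝ) ^ (-(n : ℝ)) = 2⁻¹ ^ n := by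
    rw [Real.rpow_neg (by norm_num), Real.rpow_natCast, inv_pow]
  refine Summable.of_nat_of_neg ?_ ?_
  · obtain ⟨C, hC⟩ := exists_norm_ft_scl_le_of_integral_eq_zero hf.continuous hfs hf0 ξ
    refine Summable.of_nonneg_of_le (fun n => by positivity) (fun n => ?_) (hgeo C)
    have h1 : (2 : ℝ) ^ (-(n : ℝ) * β) ≤ 1 :=
      Real.rpow_le_one_of_one_le_of_nonpos (by norm_num) (by nlinarith [n.cast_nonneg (α := ℝ)])
    simp only [Int.cast_natCast, hpow]
    refine (mul_le_of_le_one_left (norm_nonneg _) h1).trans ?_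
    exact hC _ (by positivity) (pow_le_one₀ (by norm_num) (by norm_num))
  · obtain ⟨N, hN⟩ := exists_nat_ge (β + 1)
    obtain ⟨C, hC⟩ := exists_norm_ft_scl_le hf hfs hξ N
    refine Summable.of_nonneg_of_le (fun n => by positivity) (fun n => ?_) (hgeo C)
    have h := hC (2 ^ n) (one_le_pow₀ (by norm_num))
    simp only [Int.cast_neg, Int.cast_natCast, neg_neg]
    rw [Real.rpow_natCast]
    exact rpow_mul_le_of_pow_mul_le hN n (norm_nonneg _) h

theorem exists_forall_le_of_limsup_lt_top {a : ℕ → ENNReal} (ha : ∀ n, a n ≠ ⊤)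
    (h : limsup a atTop < ⊤) : ∃ A, A ≠ ⊤ ∧ ∀ n, a n ≤ A := by
  obtain ⟨B, hB, hBtop⟩ := exists_between h
  obtain ⟨N, hN⟩ := eventually_atTop.1 (eventually_lt_of_limsup_lt hB)
  refine ⟨B + ∑ n ∈ Finset.range N, a n, ?_, fun n => ?_⟩
  · exact ENNReal.add_ne_top.2 ⟨hBtop.ne, ENNReal.sum_ne_top.2 fun n _ => ha n⟩
  · rcases lt_or_ge n N with hn | hn
    · exact (Finset.single_le_sum (f := a) (fun _ _ => zero_le) (Finset.mem_range.2 hn)).trans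
        le_add_self
    · exact (hN n hn).le.trans le_self_add

/-- A weighted sum of shifts of a bounded sequence has limsup at most the total weight times the
limsup of the sequence. -/
theorem limsup_tsum_mul_shift_le {ι : Type*} [Countable ι] {a : ℕ → ENNReal} {A : ENNReal}
    {c : ι → ENNReal} (k : ι → ℤ) (hA : A ≠ ⊤) (ha : ∀ n, a n ≤ A) (hc : ∑' i, c i ≠ ⊤) :
    limsup (fun n : ℕ => ∑' i, c i * a ((n : ℤ) + k i).toNat) atTop ≤
      (∑' i, c i) * limsup a atTop := by
  let _ : MeasurableSpace ι := ⊤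
  have h := limsup_lintegral_le (μ := Measure.count)
    (f := fun (n : ℕ) i => c i * a ((n : ℤ) + k i).toNat) (fun i => c i * A)
    (fun _ => measurable_from_top)
    (fun n => Eventually.of_forall fun i => mul_le_mul_right (ha _) (c i))
    (by rw [lintegral_count, ENNReal.tsum_mul_right]; exact ENNReal.mul_ne_top hc hA)
  simp only [lintegral_count] at h
  refine h.trans ?_
  rw [← ENNReal.tsum_mul_right]
  refine ENNReal.tsum_le_tsum fun i => ?_
  rw [ENNReal.limsup_const_mul_of_ne_top (ENNReal.ne_top_of_tsum_ne_top hc i)]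
  have ht : Tendsto (fun n : ℕ => ((n : ℤ) + k i).toNat) atTop atTop :=
    tendsto_atTop.2 fun m => by
      filter_upwards [eventually_ge_atTop (m + (k i).natAbs)] with n hn
      omega
  gcongr
  exact limsup_le_limsup_of_le (u := a) ht

/-- final estimate in the proof of Proposition 2.5.  With
R̂(ξ) = α₀ ρ̂(ξ) + ∑_(n≥1) αₙ η̂(2^(-n)·ξ), if limsup 2^(nβ)|αₙ| ∈ (0,∞) and the
non-degeneracy condition holds at ξ₀, then limsup_n 2^(nβ) |R̂(2ⁿ·ξ₀)| > 0. -/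
theorem stmt4 (β : ℝ) (hβ : 0 ≤ β)
    (ρ : (Fin 4 → ℝ) → ℝ) (hρsmooth : ContDiff ℝ (⊤ : ℕ∞) ρ)
    (hρeven : ∀ z, ρ (-z) = ρ z) (hρsupp : HasCompactSupport ρ)
    (hρint : (∫ z, ρ z) = 1)
    (η : (Fin 4 → ℝ) → ℝ)
    (hη : η = fun x => ρ x - ((2 : ℝ) ^ (5 : ℕ))⁻¹ * ρ (scl (2⁻¹ : ℝ) x))
    (ξ0 : Fin 4 → ℝ)
    (hξ0 : 0 < ‖ft η ξ0‖ -
      ∑' n : {m : ℤ // m ≠ 0},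
        (2 : ℝ) ^ (-((n : ℤ) : ℝ) * β) * ‖ft η (scl ((2 : ℝ) ^ (-((n : ℤ) : ℝ))) ξ0)‖)
    (α : ℕ → ℝ) (hα : ∃ M : ℝ, ∀ n, |α n| ≤ M)
    (hαpos : 0 < Filter.atTop.limsup
        (fun n : ℕ => ENNReal.ofReal ((2 : ℝ) ^ ((n : ℝ) * β) * |α n|)))
    (hαfin : Filter.atTop.limsup
        (fun n : ℕ => ENNReal.ofReal ((2 : ℝ) ^ ((n : ℝ) * β) * |α n|)) < ⊤)
    (Rhat : (Fin 4 → ℝ) → ℂ)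
    (hRhat : Rhat = fun ξ => (α 0 : ℂ) * ft ρ ξ +
      ∑' n : ℕ, (α (n + 1) : ℂ) * ft η (scl (((2 : ℝ) ^ (n + 1))⁻¹) ξ)) :
    0 < Filter.atTop.limsup (fun n : ℕ =>
      ENNReal.ofReal ((2 : ℝ) ^ ((n : ℝ) * β)) *
        (‖Rhat (scl ((2 : ℝ) ^ n) ξ0)‖₊ : ENNReal)) := by
  have hηsmooth : ContDiff ℝ (⊤ : ℕ∞) η := by
    rw [hη]
    refine hρsmooth.sub (contDiff_const.mul (hρsmooth.comp ?_))
    rw [contDiff_pi]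
    intro i
    unfold scl
    fun_prop
  have hρscl : HasCompactSupport (fun x => ρ (scl 2⁻¹ x)) :=
    hρsupp.comp_homeomorph (sclHomeomorph 2⁻¹ (by norm_num))
  have hηsupp : HasCompactSupport η := by
    rw [hη]
    exact hρsupp.sub hρscl.mul_left
  have hηint : ∫ z, η z = 0 := by
    have hρsclc : Continuous fun x => ρ (scl 2⁻¹ x) :=
      hρsmooth.continuous.comp (continuous_scl _)
    have h := integral_comp_scl ρ (l := 2⁻¹) (by norm_num)
    rw [hη, integral_sub (hρsmooth.continuous.integrable_of_hasCompactSupport hρsupp)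
      ((hρsclc.integrable_of_hasCompactSupport hρscl).const_mul _), integral_const_mul,
      ← inv_pow, h, sub_self]
  have hξ0ne : ξ0 ≠ 0 := by
    rintro rfl
    have h0 : ft η 0 = 0 := by simp [ft, integral_complex_ofReal, hηint]
    simp [scl_zero_right, h0] at hξ0
  set c : ℤ → ℝ := fun n =>
    (2 : ℝ) ^ (-(n : ℝ) * β) * ‖ft η (scl ((2 : ℝ) ^ (-(n : ℝ))) ξ0)‖ with hc
  have hcsum : Summable c := summable_rpow_mul_norm_ft_scl hβ hηsmooth hηsupp hηint hξ0ne
  have hc0 : ∀ n, 0 ≤ c n := fun n => by positivity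
  set a : ℕ → ENNReal := fun n => ENNReal.ofReal ((2 : ℝ) ^ ((n : ℝ) * β) * |α n|)
  obtain ⟨A, hA, haA⟩ := exists_forall_le_of_limsup_lt_top (fun n => ENNReal.ofReal_ne_top) hαfin
  have hterm (n m : ℕ) :
      ENNReal.ofReal ((2 : ℝ) ^ ((n : ℝ) * β)) *
        ‖(α (m + 1) : ℂ) * ft η (scl (((2 : ℝ) ^ (m + 1))⁻¹) (scl ((2 : ℝ) ^ n) ξ0))‖ₑ =
      ENNReal.ofReal (c ((m : ℤ) + 1 - n)) * a (m + 1) := by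
    rw [← ofReal_norm, ← ENNReal.ofReal_mul (by positivity),
      ← ENNReal.ofReal_mul (hc0 _), norm_mul, Complex.norm_real, Real.norm_eq_abs, scl_scl]
    congr 1
    have h1 : ((2 : ℝ) ^ (m + 1))⁻¹ * 2 ^ n = 2 ^ (-(((m : ℤ) + 1 - n : ℤ) : ℝ)) := by
      rw [← Real.rpow_natCast, ← Real.rpow_natCast, ← Real.rpow_neg (by norm_num),
        ← Real.rpow_add (by norm_num)]
      congr 1
      push_cast
      ring
    have h2 : (2 : ℝ) ^ ((n : ℝ) * β) =
        2 ^ (-(((m : ℤ) + 1 - n : ℤ) : ℝ) * β) * 2 ^ (((m + 1 : ℕ) : ℝ) * β) := by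
      rw [← Real.rpow_add (by norm_num)]
      congr 1
      push_cast
      ring
    simp only [hc]
    rw [h1, h2]
    ring
  set S : ENNReal := ∑' k : {m : ℤ // m ≠ 0}, ENNReal.ofReal (c k) with hS
  have hSeq : S = ENNReal.ofReal (∑' k : {m : ℤ // m ≠ 0}, c k) :=
    (ENNReal.ofReal_tsum_of_nonneg (fun k => hc0 _) (hcsum.subtype _)).symm
  have hSlt : S < ENNReal.ofReal ‖ft η ξ0‖ := by
    rw [hSeq]
    exact ENNReal.ofReal_lt_ofReal_iff'.2
      ⟨sub_pos.1 hξ0, (tsum_nonneg fun k => hc0 _).trans_lt (sub_pos.1 hξ0)⟩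
  set b : ℕ → ENNReal := fun n => ENNReal.ofReal ((2 : ℝ) ^ ((n : ℝ) * β)) *
    (‖Rhat (scl ((2 : ℝ) ^ n) ξ0)‖₊ : ENNReal)
  set r : ℕ → ENNReal := fun n => ENNReal.ofReal ((2 : ℝ) ^ ((n : ℝ) * β)) *
    ‖(α 0 : ℂ) * ft ρ (scl ((2 : ℝ) ^ n) ξ0)‖ₑ with hr
  have hr0 : Tendsto r atTop (𝓝 0) := by
    obtain ⟨N, hN⟩ := exists_nat_ge (β + 1)
    obtain ⟨C, hC⟩ := exists_norm_ft_scl_le hρsmooth hρsupp hξ0ne N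
    have hlim : Tendsto (fun n : ℕ => ENNReal.ofReal (|α 0| * C * 2⁻¹ ^ n)) atTop (𝓝 0) := by
      simpa using ENNReal.tendsto_ofReal ((tendsto_pow_atTop_nhds_zero_of_lt_one (r := (2⁻¹ : ℝ))
        (by norm_num) (by norm_num)).const_mul (|α 0| * C))
    refine tendsto_of_tendsto_of_tendsto_of_le_of_le tendsto_const_nhds hlim
      (fun _ => zero_le) fun n => ?_
    simp only [hr]
    rw [← ofReal_norm, ← ENNReal.ofReal_mul (by positivity), norm_mul, Complex.norm_real,
      Real.norm_eq_abs]
    refine ENNReal.ofReal_le_ofReal ?_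
    have h := rpow_mul_le_of_pow_mul_le hN n (norm_nonneg (ft ρ (scl (2 ^ n) ξ0)))
      (hC (2 ^ n) (one_le_pow₀ (by norm_num)))
    calc _ = |α 0| * ((2 : ℝ) ^ ((n : ℝ) * β) * ‖ft ρ (scl (2 ^ n) ξ0)‖) := by ring
      _ ≤ |α 0| * (C * 2⁻¹ ^ n) := by gcongr
      _ = _ := by ring
  set T : ℕ → ENNReal := fun n =>
    ∑' k : {m : ℤ // m ≠ 0}, ENNReal.ofReal (c k) * a ((n : ℤ) + k).toNat
  have hTlim : limsup T atTop ≤ S * limsup a atTop :=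
    limsup_tsum_mul_shift_le (fun k : {m : ℤ // m ≠ 0} => (k : ℤ)) hA haA
      (by rw [← hS]; exact hSlt.ne_top)
  have hmain : ∀ᶠ n in atTop, ENNReal.ofReal ‖ft η ξ0‖ * a n ≤ (b + r + T) n := by
    filter_upwards [eventually_ge_atTop 1] with n hn
    obtain ⟨p, rfl⟩ : ∃ p, n = p + 1 := ⟨n - 1, by omega⟩
    set w : ENNReal := ENNReal.ofReal ((2 : ℝ) ^ (((p + 1 : ℕ) : ℝ) * β)) with hw
    set F : ℕ → ℂ := fun m =>
      (α (m + 1) : ℂ) * ft η (scl (((2 : ℝ) ^ (m + 1))⁻¹) (scl ((2 : ℝ) ^ (p + 1)) ξ0))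
    have hwF (m : ℕ) : w * ‖F m‖ₑ = ENNReal.ofReal (c ((m : ℤ) + 1 - (p + 1 : ℕ))) * a (m + 1) :=
      hterm (p + 1) m
    have hw0 : w ≠ 0 := by simp only [hw, ne_eq, ENNReal.ofReal_eq_zero, not_le]; positivity
    have hinj : Function.Injective fun m : ℕ => (m : ℤ) + 1 - (p + 1 : ℕ) := by
      intro x y hxy
      simp only at hxy
      omega
    have hFsum : Summable F := by
      refine Summable.of_enorm ?_
      suffices hwsum : w * ∑' m, ‖F m‖ₑ ≠ ⊤ from
        (ENNReal.lt_top_of_mul_ne_top_right hwsum hw0).ne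
      rw [← ENNReal.tsum_mul_left]
      simp only [hwF]
      refine ne_top_of_le_ne_top ?_ (ENNReal.tsum_le_tsum fun m => mul_le_mul_right (haA (m + 1)) _)
      rw [ENNReal.tsum_mul_right]
      exact ENNReal.mul_ne_top ((hcsum.comp_injective hinj).tsum_ofReal_ne_top) hA
    have hsplit : F p = Rhat (scl ((2 : ℝ) ^ (p + 1)) ξ0) -
        (α 0 : ℂ) * ft ρ (scl ((2 : ℝ) ^ (p + 1)) ξ0) -
        ∑' m : {m : ℕ // m ≠ p}, F m := by
      have h := hFsum.sum_add_tsum_subtype_compl {p}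
      have h' : ∑' m : {m : ℕ // m ∉ ({p} : Finset ℕ)}, F m = ∑' m : {m : ℕ // m ≠ p}, F m :=
        (Equiv.subtypeEquivRight fun m => Finset.mem_singleton.not).tsum_eq
          (fun m : {m : ℕ // m ≠ p} => F m)
      rw [Finset.sum_singleton, h'] at h
      simp only [hRhat]
      rw [← h]
      ring
    have htail : w * ‖∑' m : {m : ℕ // m ≠ p}, F m‖ₑ ≤ T (p + 1) := by
      refine (mul_le_mul_right enorm_tsum_le_tsum_enorm w).trans ?_
      rw [← ENNReal.tsum_mul_left]
      let φ : {m : ℕ // m ≠ p} → {k : ℤ // k ≠ 0} := fun m =>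
        ⟨(m : ℤ) + 1 - (p + 1 : ℕ), by have := m.2; omega⟩
      have hφ : Function.Injective φ := fun x y hxy =>
        Subtype.ext (hinj (congrArg Subtype.val hxy))
      refine le_trans (le_of_eq ?_) (ENNReal.tsum_comp_le_tsum_of_injective hφ _)
      refine tsum_congr fun m => ?_
      rw [hwF]
      have h3 : (((p + 1 : ℕ) : ℤ) + (φ m : ℤ)).toNat = m + 1 := by
        simp only [φ]
        omega
      rw [h3]
    calc ENNReal.ofReal ‖ft η ξ0‖ * a (p + 1) = w * ‖F p‖ₑ := by
          rw [hwF]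
          congr 2
          simp [hc, scl_one]
      _ ≤ w * (‖Rhat (scl ((2 : ℝ) ^ (p + 1)) ξ0)‖ₑ +
          ‖(α 0 : ℂ) * ft ρ (scl ((2 : ℝ) ^ (p + 1)) ξ0)‖ₑ +
          ‖∑' m : {m : ℕ // m ≠ p}, F m‖ₑ) := by
          rw [hsplit]
          gcongr
          exact enorm_sub_le.trans (by gcongr; exact enorm_sub_le)
      _ ≤ _ := by
          rw [mul_add, mul_add]
          exact add_le_add le_rfl htail
  by_contra hcon
  have hb0 : Tendsto b atTop (𝓝 0) :=
    tendsto_of_le_liminf_of_limsup_le zero_le (not_lt.1 hcon)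
  have hbr : Tendsto (b + r) atTop (𝓝 0) := by
    rw [← add_zero (0 : ENNReal)]
    exact hb0.add hr0
  have hfinal : ENNReal.ofReal ‖ft η ξ0‖ * limsup a atTop ≤ S * limsup a atTop := by
    rw [← ENNReal.limsup_const_mul_of_ne_top ENNReal.ofReal_ne_top]
    refine (limsup_le_limsup hmain).trans ?_
    rw [ENNReal.limsup_add_of_left_tendsto_zero hbr]
    exact hTlim
  exact absurd hfinal
    (not_le.2 ((ENNReal.mul_lt_mul_iff_left hαpos.ne' hαfin.ne).2 hSlt))
end
end

section
/- For every \beta \ge 0 there exist a smooth, even, compactly supported function \rho on \mathbb{R}^4 with \int_{\mathbb{R}^4}\rho = 1 and a point \xi_0 \in \mathbb{R}^4 such that, setting \eta(x) = \rho(x) - 2^{-|s|}\rho(2^{-1}\cdot x), one has |\hat{\eta}(\xi_0)| - \sum_{n\in\mathbb{Z}\setminus\{0\}} 2^{-n\beta}|\hat{\eta}(2^{-n}\cdot\xi_0)| > 0. -/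
open MeasureTheory Filter Topology

noncomputable section

/-- An even smooth bump supported in `[-3/5, 3/5]` whose integer translates sum to one. -/
def unityBump (x : ℝ) : ℝ := Real.smoothTransition (3 - 5 * x) * Real.smoothTransition (3 + 5 * x)

/-- The cosine transform of `unityBump`. -/
def unityBumpCos (t : ℝ) : ℝ := ∫ x, unityBump x * Real.cos (t * x)

/-- The tensor power of `unityBump` on `ℝ⁴`. -/
def unityBump4 (z : Fin 4 → ℝ) : ℝ := ∏ i, unityBump (z i)

theorem Real.smoothTransition_add_one_sub (x : ℝ) :
    Real.smoothTransition x + Real.smoothTransition (1 - x) = 1 := by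
  have h := (Real.smoothTransition.pos_denom x).ne'
  unfold Real.smoothTransition
  rw [sub_sub_cancel, add_comm (expNegInvGlue (1 - x)), ← add_div, div_self h]

theorem unityBump_neg (x : ℝ) : unityBump (-x) = unityBump x := by
  unfold unityBump
  rw [mul_comm]
  congr 2 <;> ring

theorem unityBump_nonneg (x : ℝ) : 0 ≤ unityBump x :=
  mul_nonneg (Real.smoothTransition.nonneg _) (Real.smoothTransition.nonneg _)

theorem unityBump_contDiff : ContDiff ℝ (⊤ : ℕ∞) unityBump := by
  unfold unityBump
  fun_prop

theorem unityBump_continuous : Continuous unityBump := unityBump_contDiff.continuous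

theorem unityBump_eq_zero {x : ℝ} (hx : 3 / 5 ≤ |x|) : unityBump x = 0 := by
  unfold unityBump
  rcases le_abs.1 hx with h | h
  · rw [Real.smoothTransition.zero_of_nonpos (by linarith), zero_mul]
  · rw [Real.smoothTransition.zero_of_nonpos (x := 3 + 5 * x) (by linarith), mul_zero]

theorem unityBump_of_nonneg {x : ℝ} (hx : 0 ≤ x) :
    unityBump x = Real.smoothTransition (3 - 5 * x) := by
  rw [unityBump, Real.smoothTransition.one_of_one_le (x := 3 + 5 * x) (by linarith), mul_one]

theorem unityBump_add_sub_one {x : ℝ} (hx : x ∈ Set.Icc (0 : ℝ) 1) :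
    unityBump x + unityBump (x - 1) = 1 := by
  rw [← unityBump_neg (x - 1), unityBump_of_nonneg hx.1,
    unityBump_of_nonneg (x := -(x - 1)) (by linarith [hx.2]),
    show 3 - 5 * -(x - 1) = 1 - (3 - 5 * x) by ring, Real.smoothTransition_add_one_sub]

theorem unityBump_hasCompactSupport : HasCompactSupport unityBump := by
  refine HasCompactSupport.intro (isCompact_Icc (a := (-1 : ℝ)) (b := 1)) fun x hx => ?_
  refine unityBump_eq_zero ?_
  by_contra! h
  exact hx ⟨by linarith [(abs_lt.1 h).1], by linarith [(abs_lt.1 h).2]⟩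

theorem integrable_unityBump_mul {g : ℝ → ℝ} (hg : Continuous g) :
    Integrable fun x => unityBump x * g x :=
  (unityBump_continuous.mul hg).integrable_of_hasCompactSupport
    unityBump_hasCompactSupport.mul_right

/-- Integrating a periodic function against a partition of unity gives its integral over a
period. -/
theorem integral_unityBump_mul_periodic {g : ℝ → ℝ} (hg : Continuous g)
    (hp : Function.Periodic g 1) : ∫ x, unityBump x * g x = ∫ x in (0 : ℝ)..1, g x := by
  have hc : Continuous fun x => unityBump x * g x := unityBump_continuous.mul hg
  have hc' : Continuous fun x => unityBump (x - 1) * g x :=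
    (unityBump_continuous.comp (by fun_prop)).mul hg
  have hsupp : Function.support (fun x => unityBump x * g x) ⊆ Set.Ioc (-1) 1 := by
    intro x hx
    have h : |x| < 3 / 5 := by
      by_contra! h
      exact hx (by simp [unityBump_eq_zero h])
    exact ⟨by linarith [(abs_lt.1 h).1], by linarith [(abs_lt.1 h).2]⟩
  have hshift : ∫ x in (-1 : ℝ)..0, unityBump x * g x =
      ∫ x in (0 : ℝ)..1, unityBump (x - 1) * g x := by
    have h := intervalIntegral.integral_comp_sub_right (a := 0) (b := 1)
      (fun x => unityBump x * g x) 1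
    simp only [hp.sub_eq, sub_self, zero_sub] at h
    exact h.symm
  rw [← intervalIntegral.integral_eq_integral_of_support_subset hsupp,
    ← intervalIntegral.integral_add_adjacent_intervals (b := 0)
      (hc.intervalIntegrable _ _) (hc.intervalIntegrable _ _), hshift,
    ← intervalIntegral.integral_add (hc'.intervalIntegrable _ _) (hc.intervalIntegrable _ _)]
  refine intervalIntegral.integral_congr fun x hx => ?_
  rw [Set.uIcc_of_le zero_le_one] at hx
  rw [← add_mul, add_comm, unityBump_add_sub_one hx, one_mul]

theorem integral_unityBump : ∫ x, unityBump x = 1 := by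
  simpa using integral_unityBump_mul_periodic (g := fun _ => 1) continuous_const fun _ => rfl

theorem unityBumpCos_two_pi_mul {k : ℕ} (hk : k ≠ 0) :
    unityBumpCos (2 * Real.pi * k) = 0 := by
  have hne : 2 * Real.pi * (k : ℝ) ≠ 0 := by positivity
  have hp : Function.Periodic (fun x => Real.cos (2 * Real.pi * k * x)) 1 := fun x => by
    have h := Real.cos_add_nat_mul_two_pi (2 * Real.pi * k * x) k
    simp only
    rw [← h]
    congr 1
    ring
  rw [unityBumpCos, integral_unityBump_mul_periodic (by fun_prop) hp,
    intervalIntegral.integral_comp_mul_left (fun x => Real.cos x) hne, integral_cos]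
  have h := Real.sin_nat_mul_pi (2 * k)
  push_cast at h
  rw [mul_one, mul_zero, Real.sin_zero, show 2 * Real.pi * (k : ℝ) = 2 * k * Real.pi by ring, h]
  simp

theorem unityBumpCos_le_one (t : ℝ) : unityBumpCos t ≤ 1 := by
  rw [← integral_unityBump]
  refine integral_mono (integrable_unityBump_mul (by fun_prop))
    (by simpa using integrable_unityBump_mul (continuous_const (y := (1 : ℝ)))) fun x => ?_
  exact mul_le_of_le_one_right (unityBump_nonneg x) (Real.cos_le_one _)

theorem half_lt_unityBumpCos : 1 / 2 < unityBumpCos (Real.pi / 2) := by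
  have h : ∫ x, unityBump x * (11 / 20 : ℝ) ≤ unityBumpCos (Real.pi / 2) := by
    refine integral_mono (integrable_unityBump_mul continuous_const)
      (integrable_unityBump_mul (by fun_prop)) fun x => ?_
    rcases le_or_gt (3 / 5) |x| with hx | hx
    · simp [unityBump_eq_zero hx]
    · refine mul_le_mul_of_nonneg_left ?_ (unityBump_nonneg x)
      refine le_trans ?_ Real.one_sub_sq_div_two_le_cos
      have hpi : Real.pi ^ 2 ≤ 3.15 ^ 2 :=
        pow_le_pow_left₀ Real.pi_pos.le Real.pi_lt_d2.le 2
      have hx2 : x ^ 2 ≤ (3 / 5) ^ 2 := sq_le_sq' (abs_lt.1 hx).1.le (abs_lt.1 hx).2.le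
      have := mul_le_mul hpi hx2 (sq_nonneg x) (by norm_num)
      rw [show (Real.pi / 2 * x) ^ 2 = Real.pi ^ 2 * x ^ 2 / 4 by ring]
      norm_num at this ⊢
      linarith
  rw [integral_mul_const, integral_unityBump] at h
  linarith

theorem unityBumpCos_anti {s t : ℝ} (hs : 0 ≤ s) (hst : s ≤ t) (ht : t ≤ Real.pi) :
    unityBumpCos t ≤ unityBumpCos s := by
  refine integral_mono (integrable_unityBump_mul (by fun_prop))
    (integrable_unityBump_mul (by fun_prop)) fun x => ?_
  rcases le_or_gt (3 / 5) |x| with hx | hx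
  · simp [unityBump_eq_zero hx]
  · refine mul_le_mul_of_nonneg_left ?_ (unityBump_nonneg x)
    rw [← Real.cos_abs (t * x), ← Real.cos_abs (s * x), abs_mul, abs_mul, abs_of_nonneg hs,
      abs_of_nonneg (hs.trans hst)]
    refine Real.cos_le_cos_of_nonneg_of_le_pi (by positivity) ?_ (by gcongr)
    nlinarith [abs_nonneg x]

theorem integrable_exp_mul_unityBump (t : ℝ) {c : ℝ} (hc : c ≠ 0) :
    Integrable fun x : ℝ => Complex.exp (-Complex.I * ((t * x : ℝ) : ℂ)) *
      (unityBump (c * x) : ℂ) := by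
  have hcont : Continuous fun x : ℝ => (unityBump (c * x) : ℂ) :=
    Complex.continuous_ofReal.comp (unityBump_continuous.comp (by fun_prop))
  refine Continuous.integrable_of_hasCompactSupport (by fun_prop) (HasCompactSupport.mul_left ?_)
  exact (unityBump_hasCompactSupport.comp_homeomorph (Homeomorph.mulLeft₀ c hc)).comp_left
    (g := Complex.ofReal) Complex.ofReal_zero

theorem integral_exp_mul_unityBump (t : ℝ) :
    ∫ x : ℝ, Complex.exp (-Complex.I * ((t * x : ℝ) : ℂ)) * (unityBump x : ℂ) =
      (unityBumpCos t : ℂ) := by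
  have hodd : ∫ x, unityBump x * Real.sin (t * x) = 0 := by
    have h := integral_neg_eq_self (fun x => unityBump x * Real.sin (t * x)) volume
    simp only [unityBump_neg, mul_neg, Real.sin_neg, integral_neg] at h
    linarith
  have hpt (x : ℝ) : Complex.exp (-Complex.I * ((t * x : ℝ) : ℂ)) * (unityBump x : ℂ) =
      ((unityBump x * Real.cos (t * x) : ℝ) : ℂ) -
        ((unityBump x * Real.sin (t * x) : ℝ) : ℂ) * Complex.I := by
    rw [show -Complex.I * ((t * x : ℝ) : ℂ) = ((-(t * x) : ℝ) : ℂ) * Complex.I by push_cast; ring,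
      Complex.exp_mul_I, ← Complex.ofReal_cos, ← Complex.ofReal_sin, Real.cos_neg, Real.sin_neg]
    push_cast
    ring
  simp_rw [hpt]
  rw [integral_sub (integrable_unityBump_mul (by fun_prop)).ofReal
    ((integrable_unityBump_mul (by fun_prop)).ofReal.mul_const _), integral_mul_const,
    integral_complex_ofReal, integral_complex_ofReal, hodd, unityBumpCos]
  simp

theorem integral_exp_mul_unityBump_mul (t : ℝ) {c : ℝ} (hc : 0 < c) :
    ∫ x : ℝ, Complex.exp (-Complex.I * ((t * x : ℝ) : ℂ)) * (unityBump (c * x) : ℂ) =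
      ((c⁻¹ * unityBumpCos (t / c) : ℝ) : ℂ) := by
  have h := Measure.integral_comp_mul_left (fun x : ℝ =>
    Complex.exp (-Complex.I * ((t / c * x : ℝ) : ℂ)) * (unityBump x : ℂ)) c
  rw [integral_exp_mul_unityBump, abs_of_pos (inv_pos.2 hc)] at h
  rw [Complex.ofReal_mul, ← Complex.real_smul, ← h]
  refine integral_congr_ae (Eventually.of_forall fun x => ?_)
  simp only
  rw [show t / c * (c * x) = t * x by field_simp]

theorem exp_mul_prod (f : Fin 4 → ℝ → ℝ) (ξ z : Fin 4 → ℝ) :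
    Complex.exp (-Complex.I * ((∑ i, ξ i * z i : ℝ) : ℂ)) * ((∏ i, f i (z i) : ℝ) : ℂ) =
      ∏ i, (Complex.exp (-Complex.I * ((ξ i * z i : ℝ) : ℂ)) * (f i (z i) : ℂ)) := by
  rw [Finset.prod_mul_distrib, ← Complex.exp_sum, ← Finset.mul_sum]
  push_cast
  rfl

theorem ft_unityBump4_scl {l : ℝ} (hl : 0 < l) (ξ : Fin 4 → ℝ) :
    ft (fun z => unityBump4 (scl l z)) ξ =
      ((∏ i, (l ^ sExp i)⁻¹ * unityBumpCos (ξ i / l ^ sExp i) : ℝ) : ℂ) := by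
  unfold ft unityBump4 scl
  simp_rw [exp_mul_prod (fun i x => unityBump (l ^ sExp i * x))]
  rw [integral_fintype_prod_volume_eq_prod fun i (x : ℝ) =>
    Complex.exp (-Complex.I * ((ξ i * x : ℝ) : ℂ)) * (unityBump (l ^ sExp i * x) : ℂ)]
  simp_rw [integral_exp_mul_unityBump_mul _ (pow_pos hl _)]
  push_cast
  rfl

theorem integrable_exp_mul_unityBump4_scl {l : ℝ} (hl : 0 < l) (ξ : Fin 4 → ℝ) :
    Integrable fun z : Fin 4 → ℝ => Complex.exp (-Complex.I * ((∑ i, ξ i * z i : ℝ) : ℂ)) *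
      (unityBump4 (scl l z) : ℂ) := by
  unfold unityBump4 scl
  simp_rw [exp_mul_prod (fun i x => unityBump (l ^ sExp i * x))]
  exact Integrable.fintype_prod (f := fun i (x : ℝ) =>
    Complex.exp (-Complex.I * ((ξ i * x : ℝ) : ℂ)) * (unityBump (l ^ sExp i * x) : ℂ))
    fun i => integrable_exp_mul_unityBump _ (pow_pos hl _).ne'

theorem scl_single_zero (l t : ℝ) : scl l (Pi.single 0 t) = Pi.single 0 (l ^ 2 * t) := by
  ext i
  fin_cases i <;> simp [scl, sExp]

theorem unityBumpCos_zero : unityBumpCos 0 = 1 := by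
  simp [unityBumpCos, integral_unityBump]

theorem ft_unityBump4_sub (t : ℝ) :
    ft (fun x => unityBump4 x - ((2 : ℝ) ^ (5 : ℕ))⁻¹ * unityBump4 (scl (2⁻¹ : ℝ) x))
      (Pi.single 0 t) = ((unityBumpCos t - unityBumpCos (4 * t) : ℝ) : ℂ) := by
  have h1 := ft_unityBump4_scl one_pos (Pi.single 0 t)
  have h2 := ft_unityBump4_scl (l := 2⁻¹) (by norm_num) (Pi.single 0 t)
  have i1 := integrable_exp_mul_unityBump4_scl one_pos (Pi.single 0 t)
  have i2 := integrable_exp_mul_unityBump4_scl (l := 2⁻¹) (by norm_num) (Pi.single 0 t)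
  simp only [scl_one] at h1 i1
  have hsub : ft (fun x => unityBump4 x - ((2 : ℝ) ^ (5 : ℕ))⁻¹ * unityBump4 (scl (2⁻¹ : ℝ) x))
      (Pi.single 0 t) = ft unityBump4 (Pi.single 0 t) - ((2 : ℂ) ^ (5 : ℕ))⁻¹ *
        ft (fun x => unityBump4 (scl (2⁻¹ : ℝ) x)) (Pi.single 0 t) := by
    unfold ft
    rw [← integral_const_mul, ← integral_sub i1 (i2.const_mul _)]
    refine integral_congr_ae (Eventually.of_forall fun x => ?_)
    push_cast
    ring
  rw [hsub, h1, h2]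
  simp [Fin.prod_univ_four, sExp, unityBumpCos_zero]
  ring_nf

theorem unityBump4_hasCompactSupport : HasCompactSupport unityBump4 := by
  refine HasCompactSupport.intro (isCompact_Icc (a := (-1 : Fin 4 → ℝ)) (b := 1)) fun z hz => ?_
  by_contra h
  have hi (i : Fin 4) : |z i| < 3 / 5 := by
    by_contra! hi
    exact h (Finset.prod_eq_zero (Finset.mem_univ i) (unityBump_eq_zero hi))
  exact hz ⟨fun i => by simp only [Pi.neg_apply, Pi.one_apply]; linarith [(abs_lt.1 (hi i)).1],
    fun i => by simp only [Pi.one_apply]; linarith [(abs_lt.1 (hi i)).2]⟩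

/-- Lemma 2.6 of the paper.  For every β ≥ 0 there exist a smooth, even,
compactly supported ρ with ∫ ρ = 1 and a point ξ₀ such that, with
η(x) = ρ(x) - 2^(-|s|) ρ(2⁻¹·x), one has
|η̂(ξ₀)| - ∑_(n ∈ ℤ∖{0}) 2^(-nβ) |η̂(2^(-n)·ξ₀)| > 0. -/
theorem stmt5 (β : ℝ) (hβ : 0 ≤ β) :
    ∃ (ρ : (Fin 4 → ℝ) → ℝ) (ξ0 : Fin 4 → ℝ),
      ContDiff ℝ (⊤ : ℕ∞) ρ ∧ (∀ z, ρ (-z) = ρ z) ∧ HasCompactSupport ρ ∧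
      (∫ z, ρ z) = 1 ∧
      0 < ‖ft (fun x => ρ x - ((2 : ℝ) ^ (5 : ℕ))⁻¹ * ρ (scl (2⁻¹ : ℝ) x)) ξ0‖ -
        ∑' n : {m : ℤ // m ≠ 0},
          (2 : ℝ) ^ (-((n : ℤ) : ℝ) * β) *
            ‖ft (fun x => ρ x - ((2 : ℝ) ^ (5 : ℕ))⁻¹ * ρ (scl (2⁻¹ : ℝ) x))
              (scl ((2 : ℝ) ^ (-((n : ℤ) : ℝ))) ξ0)‖ := by
  have hcont : ContDiff ℝ (⊤ : ℕ∞) unityBump4 :=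
    contDiff_prod fun i _ => unityBump_contDiff.comp (contDiff_apply ℝ ℝ i)
  have hint : ∫ z, unityBump4 z = 1 := by
    unfold unityBump4
    rw [integral_fintype_prod_volume_eq_prod fun _ => unityBump]
    simp [integral_unityBump]
  refine ⟨unityBump4, Pi.single 0 (Real.pi / 2), hcont, fun z => by simp [unityBump4, unityBump_neg],
    unityBump4_hasCompactSupport, hint, ?_⟩
  simp_rw [scl_single_zero, ft_unityBump4_sub, Complex.norm_real, Real.norm_eq_abs]
  have hmain : unityBumpCos (4 * (Real.pi / 2)) = 0 := by
    simpa [show 4 * (Real.pi / 2) = 2 * Real.pi by ring] using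
      unityBumpCos_two_pi_mul one_ne_zero
  have hinj : Function.Injective fun k : ℕ => (⟨(k : ℤ) + 1, by lia⟩ : {m : ℤ // m ≠ 0}) :=
    fun a b hab => by simpa using hab
  rw [← hinj.tsum_eq]
  · have hpow (k : ℕ) : ((2 : ℝ) ^ (-(((k : ℤ) + 1 : ℤ) : ℝ))) ^ 2 = (1 / 4) ^ (k + 1) := by
      rw [Real.rpow_neg zero_le_two]
      rw [show (((k : ℤ) + 1 : ℤ) : ℝ) = ((k + 1 : ℕ) : ℝ) by push_cast; rfl, Real.rpow_natCast,
        ← inv_pow, ← pow_mul, mul_comm, pow_mul]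
      norm_num
    set d : ℕ → ℝ := fun k => unityBumpCos ((1 / 4) ^ k * (Real.pi / 2)) with hd
    have hstep (k : ℕ) : d k ≤ d (k + 1) := by
      have h1 : (1 / 4 : ℝ) ^ k ≤ 1 := pow_le_one₀ (by norm_num) (by norm_num)
      refine unityBumpCos_anti (by positivity) ?_ ?_
      · rw [pow_succ]
        nlinarith [Real.pi_pos, pow_pos (show (0 : ℝ) < 1 / 4 by norm_num) k]
      · nlinarith [Real.pi_pos]
    have hsum : ∑' k : ℕ, (2 : ℝ) ^ (-(((k : ℤ) + 1 : ℤ) : ℝ) * β) *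
        |unityBumpCos (((2 : ℝ) ^ (-(((k : ℤ) + 1 : ℤ) : ℝ))) ^ 2 * (Real.pi / 2)) -
          unityBumpCos (4 * (((2 : ℝ) ^ (-(((k : ℤ) + 1 : ℤ) : ℝ))) ^ 2 * (Real.pi / 2)))| ≤
        1 - d 0 := by
      refine Real.tsum_le_of_sum_range_le (fun k => by positivity) fun N => ?_
      calc _ ≤ ∑ k ∈ Finset.range N, (d (k + 1) - d k) := by
            refine Finset.sum_le_sum fun k _ => ?_
            have h4 : 4 * ((1 / 4 : ℝ) ^ (k + 1) * (Real.pi / 2)) =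
                (1 / 4) ^ k * (Real.pi / 2) := by
              rw [pow_succ]
              ring
            rw [hpow, h4, abs_of_nonneg (sub_nonneg.2 (hstep k))]
            refine mul_le_of_le_one_left (sub_nonneg.2 (hstep k)) ?_
            refine Real.rpow_le_one_of_one_le_of_nonpos one_le_two ?_
            push_cast
            nlinarith [show (0 : ℝ) ≤ k from k.cast_nonneg]
        _ = d N - d 0 := Finset.sum_range_sub d N
        _ ≤ 1 - d 0 := sub_le_sub_right (unityBumpCos_le_one _) _
    have hd0 : d 0 = unityBumpCos (Real.pi / 2) := by simp [hd]
    have hhalf := half_lt_unityBumpCos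
    rw [hmain, sub_zero, abs_of_pos (by linarith)]
    linarith
  · rintro ⟨m, hm⟩ hsupp
    rcases lt_or_gt_of_ne hm with hneg | hpos
    · obtain ⟨j, rfl⟩ : ∃ j : ℕ, m = -((j : ℤ) + 1) := ⟨(-m - 1).toNat, by lia⟩
      refine absurd ?_ hsupp
      have h2 : ((2 : ℝ) ^ (-((-((j : ℤ) + 1) : ℤ) : ℝ))) ^ 2 * (Real.pi / 2) =
          2 * Real.pi * ((4 ^ j : ℕ) : ℝ) := by
        rw [show -((-((j : ℤ) + 1) : ℤ) : ℝ) = ((j + 1 : ℕ) : ℝ) by push_cast; ring,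
          Real.rpow_natCast, ← pow_mul, mul_comm (j + 1), pow_mul, pow_succ]
        push_cast
        norm_num
        ring
      have h3 : 4 * (2 * Real.pi * ((4 ^ j : ℕ) : ℝ)) = 2 * Real.pi * ((4 ^ (j + 1) : ℕ) : ℝ) := by
        push_cast
        ring
      simp only [h2, h3]
      rw [unityBumpCos_two_pi_mul (by positivity), unityBumpCos_two_pi_mul (by positivity)]
      simp
    · exact ⟨(m - 1).toNat, Subtype.ext (by simp only; lia)⟩
end
end

section
/- Suppose the family (R_n)_{n\ge 0} satisfies Assumption R with parameter \beta \ge 0, and let \eta be a smooth, compactly supported function on \mathbb{R}^4 with vanishing moments up to order q for some q > \beta - |s| (i.e., \int_{\mathbb{R}^4} y^k\eta(y)\,dy = 0 for every multi-index k \in \mathbb{N}^4 with |k|_s < q). Then there exists C > 0 such that for all \lambda \in (0,1] and all z \in \mathbb{R}^4: |\sum_{n\ge 0}(R_n^{\lambda^{-1}}*\eta)(z)| \le C\,\lambda^{\beta}\,(1+|z|_s)^{-|s|-q+\beta}, where R_n^{\lambda^{-1}}(y) := \lambda^{|s|}R_n(\lambda\cdot y) and * is convolution on \mathbb{R}^4.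 -/
open MeasureTheory Filter Topology

noncomputable section

theorem snorm4_le_iff {ρ : ℝ} (hρ : 0 ≤ ρ) (z : Fin 4 → ℝ) :
    snorm4 z ≤ ρ ↔ ∀ i, |z i| ≤ ρ ^ sExp i := by
  rw [snorm4, ciSup_le_iff (Set.finite_range _).bddAbove]
  refine forall_congr' fun i => ?_
  rw [Real.rpow_inv_le_iff_of_pos (abs_nonneg _) hρ (by exact_mod_cast one_le_sExp i),
    Real.rpow_natCast]

theorem snorm4_nonneg (z : Fin 4 → ℝ) : 0 ≤ snorm4 z :=
  Real.iSup_nonneg fun _ => by positivity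

theorem abs_le_snorm4_pow (z : Fin 4 → ℝ) (i : Fin 4) : |z i| ≤ snorm4 z ^ sExp i :=
  (snorm4_le_iff (snorm4_nonneg z) z).1 le_rfl i

theorem snorm4_add_le (x y : Fin 4 → ℝ) : snorm4 (x + y) ≤ snorm4 x + snorm4 y := by
  rw [snorm4_le_iff (add_nonneg (snorm4_nonneg x) (snorm4_nonneg y))]
  intro i
  calc |(x + y) i| ≤ |x i| + |y i| := abs_add_le _ _
    _ ≤ snorm4 x ^ sExp i + snorm4 y ^ sExp i :=
      add_le_add (abs_le_snorm4_pow x i) (abs_le_snorm4_pow y i)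
    _ ≤ _ := pow_add_pow_le (snorm4_nonneg x) (snorm4_nonneg y) (by have := one_le_sExp i; omega)

theorem exists_snorm4_le_of_hasCompactSupport {η : (Fin 4 → ℝ) → ℝ} (hs : HasCompactSupport η) :
    ∃ K ≥ 0, ∀ y, η y ≠ 0 → snorm4 y ≤ K := by
  obtain ⟨K, hK⟩ := hs.isCompact.isBounded.exists_norm_le
  refine ⟨max K 1, by positivity, fun y hy => ?_⟩
  rw [snorm4_le_iff (by positivity)]
  intro i
  calc |y i| ≤ ‖y‖ := norm_le_pi_norm y i
    _ ≤ max K 1 := (hK y (subset_tsupport _ hy)).trans (le_max_left _ _)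
    _ ≤ _ := le_self_pow₀ (le_max_right _ _) (by have := one_le_sExp i; omega)

theorem ksize_zero : ksize 0 = 0 := by simp [ksize]

theorem ksize_add (k m : Fin 4 → ℕ) : ksize (k + m) = ksize k + ksize m := by
  simp [ksize, mul_add, Finset.sum_add_distrib]

theorem ksize_single (i : Fin 4) : ksize (Pi.single i 1) = sExp i := by
  simp [ksize, Pi.single_apply]

theorem contDiff_pderiv1 {f : (Fin 4 → ℝ) → ℝ} (hf : ContDiff ℝ (⊤ : ℕ∞) f) (i : Fin 4) :
    ContDiff ℝ (⊤ : ℕ∞) (pderiv1 i f) :=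
  (hf.fderiv_right (m := (⊤ : ℕ∞)) (by simp)).clm_apply contDiff_const

theorem hasCompactSupport_pderiv1 {f : (Fin 4 → ℝ) → ℝ} (hf : HasCompactSupport f) (i : Fin 4) :
    HasCompactSupport (pderiv1 i f) :=
  hf.fderiv_apply ℝ _

theorem pderiv1_comm {f : (Fin 4 → ℝ) → ℝ} (hf : ContDiff ℝ (⊤ : ℕ∞) f) (i j : Fin 4) :
    pderiv1 i (pderiv1 j f) = pderiv1 j (pderiv1 i f) := by
  have hd : Differentiable ℝ (fderiv ℝ f) :=
    (hf.fderiv_right (m := (⊤ : ℕ∞)) (by simp)).differentiable (by simp)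
  have h (i j : Fin 4) (x : Fin 4 → ℝ) : pderiv1 i (pderiv1 j f) x =
      fderiv ℝ (fderiv ℝ f) x (Pi.single i 1) (Pi.single j 1) := by
    unfold pderiv1
    rw [fderiv_clm_apply (hd x) (differentiableAt_const _)]
    simp
  funext x
  rw [h, h]
  exact (hf.contDiffAt.isSymmSndFDerivAt
    (by rw [minSmoothness_of_isRCLikeNormedField]; exact WithTop.coe_le_coe.2 (le_top : (2 : ℕ∞) ≤ ⊤))) _ _

theorem contDiff_pderiv1_iterate {f : (Fin 4 → ℝ) → ℝ} (hf : ContDiff ℝ (⊤ : ℕ∞) f) (i : Fin 4)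
    (n : ℕ) : ContDiff ℝ (⊤ : ℕ∞) ((pderiv1 i)^[n] f) := by
  induction n with
  | zero => exact hf
  | succ n ih => rw [Function.iterate_succ_apply']; exact contDiff_pderiv1 ih i

theorem pderiv1_iterate_comm {f : (Fin 4 → ℝ) → ℝ} (hf : ContDiff ℝ (⊤ : ℕ∞) f) (i j : Fin 4)
    (n : ℕ) : (pderiv1 i)^[n] (pderiv1 j f) = pderiv1 j ((pderiv1 i)^[n] f) := by
  induction n with
  | zero => rfl
  | succ n ih =>
    rw [Function.iterate_succ_apply', Function.iterate_succ_apply', ih,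
      pderiv1_comm (contDiff_pderiv1_iterate hf i n)]

theorem pderivM_pderiv1 {f : (Fin 4 → ℝ) → ℝ} (hf : ContDiff ℝ (⊤ : ℕ∞) f) (k : Fin 4 → ℕ)
    (i : Fin 4) : pderivM k (pderiv1 i f) = pderivM (k + Pi.single i 1) f := by
  have h3 := contDiff_pderiv1_iterate hf 3 (k 3)
  have h2 := contDiff_pderiv1_iterate h3 2 (k 2)
  have h1 := contDiff_pderiv1_iterate h2 1 (k 1)
  fin_cases i <;>
    simp [pderivM, pderiv1_iterate_comm, hf, h3, h2,
      h1]

theorem pderivM_zero (f : (Fin 4 → ℝ) → ℝ) : pderivM 0 f = f := rfl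

theorem pderiv1_comp_scl {f : (Fin 4 → ℝ) → ℝ} (hf : Differentiable ℝ f) (c l : ℝ) (i : Fin 4) :
    pderiv1 i (fun y => c * f (scl l y)) = fun y => (c * l ^ sExp i) * pderiv1 i f (scl l y) := by
  funext y
  have hscl : HasFDerivAt (scl l) (ContinuousLinearMap.pi fun j =>
      (l ^ sExp j) • (ContinuousLinearMap.proj j : (Fin 4 → ℝ) →L[ℝ] ℝ)) y := by
    rw [hasFDerivAt_pi]
    intro j
    exact ((ContinuousLinearMap.proj j : (Fin 4 → ℝ) →L[ℝ] ℝ).hasFDerivAt).const_mul _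
  have h := ((hf (scl l y)).hasFDerivAt.comp y hscl).const_mul c
  have he : (ContinuousLinearMap.pi fun j =>
      (l ^ sExp j) • (ContinuousLinearMap.proj j : (Fin 4 → ℝ) →L[ℝ] ℝ)) (Pi.single i 1) =
      (l ^ sExp i) • (Pi.single i 1 : Fin 4 → ℝ) := by
    ext j
    by_cases hj : j = i
    · subst hj; simp
    · simp [hj]
  have h' : fderiv ℝ (fun y => c * f (scl l y)) y = _ := h.fderiv
  rw [pderiv1, h', smul_apply, ContinuousLinearMap.comp_apply, he, map_smul]
  simp only [smul_eq_mul, pderiv1]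
  ring

theorem pderiv1_iterate_comp_scl {f : (Fin 4 → ℝ) → ℝ} (hf : ContDiff ℝ (⊤ : ℕ∞) f) (c l : ℝ)
    (i : Fin 4) (n : ℕ) : (pderiv1 i)^[n] (fun y => c * f (scl l y)) =
      fun y => (c * l ^ (sExp i * n)) * (pderiv1 i)^[n] f (scl l y) := by
  induction n with
  | zero => simp
  | succ n ih =>
    rw [Function.iterate_succ_apply', ih, pderiv1_comp_scl
      ((contDiff_pderiv1_iterate hf i n).differentiable (by simp)), Function.iterate_succ_apply',
      mul_add, pow_add, mul_one, mul_assoc]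

theorem pderivM_comp_scl {f : (Fin 4 → ℝ) → ℝ} (hf : ContDiff ℝ (⊤ : ℕ∞) f) (c l : ℝ)
    (k : Fin 4 → ℕ) : pderivM k (fun y => c * f (scl l y)) =
      fun y => (c * l ^ ksize k) * pderivM k f (scl l y) := by
  have h3 := contDiff_pderiv1_iterate hf 3 (k 3)
  have h2 := contDiff_pderiv1_iterate h3 2 (k 2)
  have h1 := contDiff_pderiv1_iterate h2 1 (k 1)
  have hk : l ^ ksize k = l ^ (sExp 3 * k 3) * l ^ (sExp 2 * k 2) * l ^ (sExp 1 * k 1) *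
      l ^ (sExp 0 * k 0) := by
    rw [← pow_add, ← pow_add, ← pow_add, ← Real.rpow_natCast]
    congr 1
    simp only [ksize, Fin.sum_univ_four]
    push_cast
    ring
  simp only [pderivM, Function.comp_apply]
  rw [pderiv1_iterate_comp_scl hf, pderiv1_iterate_comp_scl h3, pderiv1_iterate_comp_scl h2,
    pderiv1_iterate_comp_scl h1, hk]
  funext y
  ring

theorem hasDerivAt_integral_comp_sub_smul {F η : (Fin 4 → ℝ) → ℝ}
    (hF : ContDiff ℝ (⊤ : ℕ∞) F) (hFs : HasCompactSupport F) (hη : Continuous η)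
    (hηs : HasCompactSupport η) (z : Fin 4 → ℝ) (t : ℝ) :
    HasDerivAt (fun t : ℝ => ∫ y, F (z - t • y) * η y)
      (-∑ i, ∫ y, pderiv1 i F (z - t • y) * (y i * η y)) t := by
  have hFd : Continuous (fderiv ℝ F) := hF.continuous_fderiv (by simp)
  obtain ⟨D, hD⟩ := (hFs.fderiv ℝ).exists_bound_of_continuous hFd
  have hF0 := hF.continuous
  have hint (G : ℝ → (Fin 4 → ℝ) → ℝ) (hG : ∀ s, Continuous (G s)) (s : ℝ) :
      Integrable fun y => G s y * η y :=
    ((hG s).mul hη).integrable_of_hasCompactSupport hηs.mul_left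
  have hd (s : ℝ) (y : Fin 4 → ℝ) :
      HasDerivAt (fun s : ℝ => F (z - s • y) * η y) (fderiv ℝ F (z - s • y) (-y) * η y) s := by
    have h1 : HasDerivAt (fun s : ℝ => z - s • y) (-y) s := by
      simpa using ((hasDerivAt_id s).smul_const y).const_sub z
    exact ((((hF.differentiable (by simp)) _).hasFDerivAt).comp_hasDerivAt s h1).mul_const _
  have key := (hasDerivAt_integral_of_dominated_loc_of_deriv_le (μ := volume) (s := Set.univ)
    (bound := fun y => D * ‖y‖ * ‖η y‖) (F := fun s y => F (z - s • y) * η y)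
    (F' := fun s y => fderiv ℝ F (z - s • y) (-y) * η y) (x₀ := t) Filter.univ_mem
    (Filter.Eventually.of_forall fun s =>
      (hint (fun s y => F (z - s • y)) (fun s => by fun_prop) s).aestronglyMeasurable)
    (hint (fun s y => F (z - s • y)) (fun s => by fun_prop) t)
    (hint (fun s y => fderiv ℝ F (z - s • y) (-y))
      (fun s => (hFd.comp (by fun_prop)).clm_apply (by fun_prop)) t).aestronglyMeasurable
    (Filter.Eventually.of_forall fun y s _ => by
      rw [norm_mul]
      gcongr
      calc _ ≤ ‖fderiv ℝ F (z - s • y)‖ * ‖-y‖ := ContinuousLinearMap.le_opNorm _ _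
        _ ≤ D * ‖y‖ := by rw [norm_neg]; gcongr; exact hD _)
    (((continuous_const.mul continuous_norm).mul hη.norm).integrable_of_hasCompactSupport
      hηs.norm.mul_left)
    (Filter.Eventually.of_forall fun y s _ => hd s y)).2
  suffices h : -∑ i, ∫ y, pderiv1 i F (z - t • y) * (y i * η y) =
      ∫ y, fderiv ℝ F (z - t • y) (-y) * η y by rw [h]; exact key
  rw [← integral_finsetSum, ← integral_neg]
  · congr 1
    funext y
    have hy : fderiv ℝ F (z - t • y) (-y) = -∑ i, y i * pderiv1 i F (z - t • y) := by
      conv_lhs => rw [map_neg, pi_eq_sum_univ' y, map_sum]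
      simp only [map_smul, smul_eq_mul, ← pi_eq_sum_univ' y]
      rfl
    rw [hy, neg_mul, Finset.sum_mul]
    congr 1
    exact Finset.sum_congr rfl fun i _ => by ring
  · intro i _
    exact (((contDiff_pderiv1 hF i).continuous.comp (by fun_prop)).mul
      ((continuous_apply i).mul hη)).integrable_of_hasCompactSupport hηs.mul_left.mul_left

theorem prod_pow_add_single (y : Fin 4 → ℝ) (k : Fin 4 → ℕ) (i : Fin 4) :
    ∏ j, y j ^ (k + Pi.single i 1 : Fin 4 → ℕ) j = (∏ j, y j ^ k j) * y i := by
  simp only [Pi.add_apply, pow_add, Finset.prod_mul_distrib]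
  congr 1
  rw [Finset.prod_eq_single i] <;> simp +contextual

/-- Testing a smooth function against a compactly supported one with vanishing moments of scaled
degree below `q` only sees derivatives of scaled degree at least `q`. -/
theorem exists_bound_integral_of_moments (M : ℕ) : ∀ (q : ℝ), q ≤ M → ∀ η : (Fin 4 → ℝ) → ℝ,
    Continuous η → HasCompactSupport η →
    (∀ k : Fin 4 → ℕ, ksize k < q → (∫ y, (∏ i, y i ^ k i) * η y) = 0) →
    ∃ T : Finset (Fin 4 → ℕ), (∀ k ∈ T, q ≤ ksize k) ∧ ∃ C ≥ 0, ∀ F : (Fin 4 → ℝ) → ℝ,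
      ContDiff ℝ (⊤ : ℕ∞) F → HasCompactSupport F → ∀ B : ℝ,
      (∀ k ∈ T, ∀ x, |pderivM k F x| ≤ B) → ∀ t ∈ Set.Icc (0 : ℝ) 1, ∀ z : Fin 4 → ℝ,
      |∫ y, F (z - t • y) * η y| ≤ C * B := by
  have base (q : ℝ) (hq : q ≤ 0) (η : (Fin 4 → ℝ) → ℝ) (hη : Continuous η)
      (hηs : HasCompactSupport η) :
      ∃ T : Finset (Fin 4 → ℕ), (∀ k ∈ T, q ≤ ksize k) ∧ ∃ C ≥ 0, ∀ F : (Fin 4 → ℝ) → ℝ,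
      ContDiff ℝ (⊤ : ℕ∞) F → HasCompactSupport F → ∀ B : ℝ,
      (∀ k ∈ T, ∀ x, |pderivM k F x| ≤ B) → ∀ t ∈ Set.Icc (0 : ℝ) 1, ∀ z : Fin 4 → ℝ,
      |∫ y, F (z - t • y) * η y| ≤ C * B := by
    refine ⟨{0}, by simpa [ksize_zero] using hq, ∫ y, |η y|,
      integral_nonneg fun _ => abs_nonneg _, fun F _ _ B hB t _ z => ?_⟩
    have hB' : ∀ x, |F x| ≤ B := by simpa [pderivM_zero] using hB
    rw [← integral_mul_const, ← Real.norm_eq_abs]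
    refine norm_integral_le_of_norm_le
      ((hη.integrable_of_hasCompactSupport hηs).norm.mul_const B) (.of_forall fun y => ?_)
    rw [norm_mul, mul_comm, Real.norm_eq_abs, Real.norm_eq_abs]
    gcongr
    exact hB' _
  induction M with
  | zero =>
    intro q hq η hη hηs _
    exact base q (by simpa using hq) η hη hηs
  | succ M ih =>
    intro q hq η hη hηs hm
    rcases le_or_gt q 0 with hq0 | hq0
    · exact base q hq0 η hη hηs
    have hs (i : Fin 4) : (1 : ℝ) ≤ sExp i := by exact_mod_cast one_le_sExp i
    choose T hT C hC h using fun i : Fin 4 => ih (q - sExp i)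
      (by push_cast at hq; linarith [hs i]) (fun y => y i * η y)
      ((continuous_apply i).mul hη) hηs.mul_left (fun k hk => by
        rw [← hm (k + Pi.single i 1) (by rw [ksize_add, ksize_single]; linarith)]
        congr 1
        funext y
        rw [prod_pow_add_single, mul_assoc])
    classical
    refine ⟨Finset.univ.biUnion fun i => (T i).image (· + Pi.single i 1), ?_, ∑ i, C i,
      Finset.sum_nonneg fun i _ => hC i, fun F hF hFs B hB t ht z => ?_⟩
    · intro k hk
      simp only [Finset.mem_biUnion, Finset.mem_univ, true_and, Finset.mem_image] at hk
      obtain ⟨i, k, hk, rfl⟩ := hk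
      rw [ksize_add, ksize_single]
      linarith [hT i k hk]
    · have hbd (s : ℝ) (hs : s ∈ Set.Icc (0 : ℝ) 1) :
          ‖-∑ i, ∫ y, pderiv1 i F (z - s • y) * (y i * η y)‖ ≤ (∑ i, C i) * B := by
        rw [norm_neg, Finset.sum_mul]
        refine norm_sum_le_of_le _ fun i _ => ?_
        refine h i _ (contDiff_pderiv1 hF i) (hasCompactSupport_pderiv1 hFs i) B
          (fun k hk x => ?_) s hs z
        rw [pderivM_pderiv1 hF]
        exact hB _ (Finset.mem_biUnion.2 ⟨i, Finset.mem_univ _, Finset.mem_image_of_mem _ hk⟩) x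
      have hmain := norm_image_sub_le_of_norm_deriv_le_segment'
        (fun s _ => (hasDerivAt_integral_comp_sub_smul hF hFs hη hηs z s).hasDerivWithinAt)
        (fun s hs => hbd s ⟨hs.1, hs.2.le⟩) t ht
      have h0 : ∫ y, F (z - (0 : ℝ) • y) * η y = 0 := by
        have hm0 : ∫ y, η y = 0 := by simpa using hm 0 (by rwa [ksize_zero])
        simp [integral_const_mul, hm0]
      rw [h0, sub_zero, sub_zero, Real.norm_eq_abs] at hmain
      exact hmain.trans (mul_le_of_le_one_right ((norm_nonneg _).trans (hbd t ht)) ht.2)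

theorem exists_tsum_min_rpow_le {δ : ℝ} (hδ : 0 < δ) : ∃ S : ℝ, ∀ a : ℝ, 0 < a →
    (Summable fun n : ℕ => min (2 ^ n * a) (2 ^ n * a)⁻¹ ^ δ) ∧
      ∑' n : ℕ, min (2 ^ n * a) (2 ^ n * a)⁻¹ ^ δ ≤ S := by
  set g : ℤ → ℝ := fun m => (2 * (2⁻¹ : ℝ) ^ m.natAbs) ^ δ with hg
  have hgeom : Summable fun n : ℕ => (2 * (2⁻¹ : ℝ) ^ n) ^ δ := by
    have h : Summable fun n : ℕ => (2 : ℝ) ^ δ * ((2⁻¹ : ℝ) ^ δ) ^ n :=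
      (summable_geometric_of_lt_one (by positivity)
        (Real.rpow_lt_one (by norm_num) (by norm_num) hδ)).mul_left _
    refine h.congr fun n => ?_
    rw [Real.mul_rpow (by norm_num) (by positivity), ← Real.rpow_natCast, ← Real.rpow_natCast,
      ← Real.rpow_mul (by norm_num), ← Real.rpow_mul (by norm_num), mul_comm δ]
  have hsum : Summable g :=
    Summable.of_nat_of_neg (by simpa [hg] using hgeom) (by simpa [hg] using hgeom)
  refine ⟨∑' m, g m, fun a ha => ?_⟩
  obtain ⟨N, hN1, hN2⟩ := exists_mem_Ico_zpow ha (one_lt_two (α := ℝ))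
  have hinj : Function.Injective fun n : ℕ => (n : ℤ) + N := fun m n h => by
    simpa using h
  have hle (n : ℕ) : min (2 ^ n * a) (2 ^ n * a)⁻¹ ^ δ ≤ g (n + N) := by
    refine Real.rpow_le_rpow (by positivity) ?_ hδ.le
    rcases le_or_gt 0 ((n : ℤ) + N) with h | h
    · refine (min_le_right _ _).trans ?_
      have h1 : (2 : ℝ) ^ ((n : ℤ) + N).natAbs ≤ 2 ^ n * a := by
        rw [← zpow_natCast, Int.natAbs_of_nonneg h, zpow_add₀ two_ne_zero, zpow_natCast]
        gcongr
      rw [inv_pow]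
      have h2 := inv_anti₀ (by positivity) h1
      have h3 : (0 : ℝ) < (2 ^ ((n : ℤ) + N).natAbs)⁻¹ := by positivity
      linarith
    · refine (min_le_left _ _).trans ?_
      have h1 : 2 * (2⁻¹ : ℝ) ^ ((n : ℤ) + N).natAbs = 2 ^ n * 2 ^ (N + 1) := by
        rw [← zpow_natCast, inv_zpow', Int.ofNat_natAbs_of_nonpos h.le, neg_neg,
          zpow_add₀ two_ne_zero, zpow_add₀ two_ne_zero, zpow_natCast]
        ring
      rw [h1]
      gcongr
  have hs : Summable fun n : ℕ => g (n + N) := hsum.comp_injective hinj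
  have hs' : Summable fun n : ℕ => min (2 ^ n * a) (2 ^ n * a)⁻¹ ^ δ :=
    hs.of_nonneg_of_le (fun n => by positivity) hle
  exact ⟨hs', (hs'.tsum_le_tsum hle hs).trans
    (tsum_comp_le_tsum_of_inj hsum (fun m => by positivity) hinj)⟩

theorem snorm4_le_of_snorm4_scl_le {l ρ : ℝ} (hl : 0 < l) {y : Fin 4 → ℝ}
    (h : snorm4 (scl l y) ≤ ρ) : snorm4 y ≤ ρ / l := by
  have hρ : 0 ≤ ρ := (snorm4_nonneg _).trans h
  rw [snorm4_le_iff (by positivity)]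
  intro i
  have hi := (snorm4_le_iff hρ _).1 h i
  rw [scl, abs_mul, abs_of_pos (pow_pos hl _)] at hi
  rw [div_pow, le_div_iff₀ (pow_pos hl _)]
  linarith

theorem mem_Icc_of_snorm4_le {ρ : ℝ} {y : Fin 4 → ℝ} (h : snorm4 y ≤ ρ) :
    y ∈ Set.Icc (fun i => -ρ ^ sExp i) (fun i => ρ ^ sExp i) := by
  have h' := (snorm4_le_iff ((snorm4_nonneg y).trans h) y).1 h
  exact ⟨fun i => (abs_le.1 (h' i)).1, fun i => (abs_le.1 (h' i)).2⟩

theorem hasCompactSupport_of_snorm4_le {F : (Fin 4 → ℝ) → ℝ} {ρ : ℝ}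
    (h : ∀ y, F y ≠ 0 → snorm4 y ≤ ρ) : HasCompactSupport F :=
  HasCompactSupport.of_support_subset_isCompact isCompact_Icc
    fun y hy => mem_Icc_of_snorm4_le (h y hy)

theorem abs_integral_mul_le_of_snorm4_le {F h : (Fin 4 → ℝ) → ℝ} {ρ B D : ℝ} (hρ : 0 ≤ ρ)
    (hF : ∀ y, F y ≠ 0 → snorm4 y ≤ ρ) (hB : ∀ y, |F y| ≤ B)
    (hD : ∀ y, snorm4 y ≤ ρ → |h y| ≤ D) : |∫ y, F y * h y| ≤ B * D * (16 * ρ ^ 5) := by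
  have hB0 : 0 ≤ B := (abs_nonneg _).trans (hB 0)
  have hD0 : 0 ≤ D := (abs_nonneg _).trans (hD 0 ((snorm4_le_iff hρ 0).2 fun i => by
    simpa using pow_nonneg hρ _))
  set s := Set.Icc (fun i => -ρ ^ sExp i) (fun i => ρ ^ sExp i)
  have hvol : volume.real s = 16 * ρ ^ 5 := by
    rw [Measure.real, Real.volume_Icc_pi_toReal fun i => by
      have := pow_nonneg hρ (sExp i); simp only; linarith]
    simp [Fin.prod_univ_four, sExp]
    ring
  rw [← setIntegral_eq_integral_of_forall_compl_eq_zero (s := s) fun y hy => ?_, ← hvol,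
    ← Real.norm_eq_abs]
  · refine norm_setIntegral_le_of_norm_le_const isCompact_Icc.measure_lt_top fun y _ => ?_
    rw [norm_mul, Real.norm_eq_abs, Real.norm_eq_abs]
    by_cases h0 : F y = 0
    · rw [h0, abs_zero, zero_mul]
      positivity
    · exact mul_le_mul (hB y) (hD y (hF y h0)) (abs_nonneg _) hB0
  · by_contra h0
    exact hy (mem_Icc_of_snorm4_le (hF y (left_ne_zero_of_mul h0)))

theorem integral_comp_scl_eq_zero {f : (Fin 4 → ℝ) → ℝ} (hf : Continuous f) {l : ℝ} (hl : 0 < l)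
    (h : ∫ y, f y = 0) : ∫ y, f (scl l y) = 0 := by
  have hdet : (Matrix.diagonal fun i => l ^ sExp i).det ≠ 0 := by
    rw [Matrix.det_diagonal]
    exact Finset.prod_ne_zero_iff.2 fun i _ => (pow_pos hl _).ne'
  have hscl : scl l = ⇑(Matrix.toLin' (Matrix.diagonal fun i => l ^ sExp i)) := by
    funext y i
    simp [scl, Matrix.mulVec_diagonal]
  have hc : Continuous (scl l) := by unfold scl; fun_prop
  rw [← integral_map hc.aemeasurable hf.aestronglyMeasurable, hscl,
    Real.map_matrix_volume_pi_eq_smul_volume_pi hdet, integral_smul_measure, h, smul_zero]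

theorem contDiff_mul_comp_scl {f : (Fin 4 → ℝ) → ℝ} (hf : ContDiff ℝ (⊤ : ℕ∞) f) (c l : ℝ) :
    ContDiff ℝ (⊤ : ℕ∞) fun y => c * f (scl l y) := by
  refine contDiff_const.mul (hf.comp ?_)
  unfold scl
  fun_prop

theorem abs_pderivM_rescale_le {f : (Fin 4 → ℝ) → ℝ} (hf : ContDiff ℝ (⊤ : ℕ∞) f) {β l c : ℝ}
    (hl : 0 < l) (n : ℕ) (k : Fin 4 → ℕ)
    (hc : ∀ z, |pderivM k f z| ≤ c * (2 : ℝ) ^ ((n : ℝ) * (5 + ksize k - β))) (y : Fin 4 → ℝ) :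
    |pderivM k (fun y => l ^ 5 * f (scl l y)) y| ≤
      c * l ^ β * (2 ^ n * l) ^ (5 + ksize k - β) := by
  have hle : l ^ 5 * l ^ ksize k = l ^ β * l ^ (5 + ksize k - β) := by
    rw [← Real.rpow_add hl, ← Real.rpow_natCast, ← Real.rpow_add hl]
    congr 1
    push_cast
    ring
  rw [pderivM_comp_scl hf, abs_mul, abs_of_pos (by positivity), hle]
  calc _ ≤ l ^ β * l ^ (5 + ksize k - β) * (c * (2 : ℝ) ^ ((n : ℝ) * (5 + ksize k - β))) := by
        gcongr
        exact hc _
    _ = _ := by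
        rw [Real.mul_rpow (by positivity) hl.le, Real.rpow_mul zero_le_two, Real.rpow_natCast]
        ring

theorem snorm4_le_of_rescale_ne_zero {f : (Fin 4 → ℝ) → ℝ} {C₀ l : ℝ} (hl : 0 < l) {n : ℕ}
    (hf : ∀ z, f z ≠ 0 → snorm4 z ≤ C₀ * (2 : ℝ) ^ (-(n : ℝ))) (y : Fin 4 → ℝ)
    (hy : l ^ 5 * f (scl l y) ≠ 0) : snorm4 y ≤ C₀ / (2 ^ n * l) := by
  have h := snorm4_le_of_snorm4_scl_le hl (hf _ (right_ne_zero_of_mul hy))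
  rwa [Real.rpow_neg zero_le_two, Real.rpow_natCast, ← div_eq_mul_inv, div_div] at h

theorem sExp_le_two (i : Fin 4) : sExp i ≤ 2 := by fin_cases i <;> simp [sExp]

theorem norm_le_of_snorm4_le_div {C t : ℝ} (hC : 1 ≤ C) (ht : 1 ≤ t) {y : Fin 4 → ℝ}
    (hy : snorm4 y ≤ C / t) : ‖y‖ ≤ C ^ 2 / t := by
  have hC0 : 0 ≤ C := zero_le_one.trans hC
  have ht0 : 0 < t := zero_lt_one.trans_le ht
  rw [pi_norm_le_iff_of_nonneg (by positivity)]
  intro i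
  calc |y i| ≤ (C / t) ^ sExp i := (snorm4_le_iff (by positivity) y).1 hy i
    _ = C ^ sExp i / t ^ sExp i := div_pow _ _ _
    _ ≤ _ := div_le_div₀ (by positivity) (pow_le_pow_right₀ hC (sExp_le_two i)) ht0
      (le_self_pow₀ ht (by have := one_le_sExp i; omega))

/-- Rescaled kernels below unit scale: the convolution decays like a positive power of the scale,
directly if `β > 0` and through cancellation if `β = 0`. -/
theorem AssumptionR.exists_bound_small_scale {R : ℕ → (Fin 4 → ℝ) → ℝ} {β : ℝ}
    (hR : AssumptionR R β) {η : (Fin 4 → ℝ) → ℝ} (hη : ContDiff ℝ (⊤ : ℕ∞) η)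
    (hηs : HasCompactSupport η) :
    ∃ δ : ℝ, 0 < δ ∧ ∃ A ≥ 0, ∀ l ∈ Set.Ioc (0 : ℝ) 1, ∀ (n : ℕ), 1 < 2 ^ n * l → ∀ z : Fin 4 → ℝ,
      |∫ y, (l ^ 5 * R n (scl l y)) * η (z - y)| ≤ A * l ^ β * (2 ^ n * l) ^ (-δ) := by
  obtain ⟨C₀, -, hsupp'⟩ := hR.support
  set C₁ := max C₀ 1
  have hC₁ : 1 ≤ C₁ := le_max_right _ _
  have hsupp : ∀ n z, R n z ≠ 0 → snorm4 z ≤ C₁ * (2 : ℝ) ^ (-(n : ℝ)) := fun n z h =>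
    (hsupp' n z h).trans (by gcongr; exact le_max_left _ _)
  obtain ⟨c, hc0, hc⟩ := hR.deriv_bound 0
  have hpt (l : ℝ) (hl : 0 < l) (n : ℕ) (y : Fin 4 → ℝ) :
      |l ^ 5 * R n (scl l y)| ≤ c * l ^ β * (2 ^ n * l) ^ (5 - β) := by
    simpa [ksize_zero, pderivM_zero] using
      abs_pderivM_rescale_le (β := β) (hR.smooth n) hl n 0 (hc n) y
  have hscale (t a : ℝ) (ht : 0 < t) : t ^ (5 - β) * a * (16 * (C₁ / t) ^ 5) =
      16 * C₁ ^ 5 * (a * t ^ (-β)) := by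
    rw [sub_eq_add_neg, Real.rpow_add ht, div_pow, show (5 : ℝ) = (5 : ℕ) by norm_num,
      Real.rpow_natCast]
    field_simp
  rcases hR.beta_nonneg.eq_or_lt with hβ | hβ
  · obtain ⟨L, hL⟩ := hη.lipschitzWith_of_hasCompactSupport hηs (by simp)
    refine ⟨1, one_pos, c * (16 * C₁ ^ 5) * (L * C₁ ^ 2), by positivity, fun l hl n hn z => ?_⟩
    have hl0 := hl.1
    have hn1 : 1 ≤ n := by
      by_contra h
      obtain rfl : n = 0 := by omega
      linarith [hl.2, pow_zero (2 : ℝ)]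
    have ht : 0 < 2 ^ n * l := by positivity
    have hs := snorm4_le_of_rescale_ne_zero hl.1 (hsupp n)
    have hFc : Continuous fun y => l ^ 5 * R n (scl l y) :=
      (contDiff_mul_comp_scl (hR.smooth n) _ l).continuous
    have hFs := hasCompactSupport_of_snorm4_le hs
    have h0 : ∫ y, l ^ 5 * R n (scl l y) = 0 := by
      rw [integral_const_mul, integral_comp_scl_eq_zero (hR.smooth n).continuous hl.1
        (hR.mean_zero hβ.symm n hn1), mul_zero]
    have heq : ∫ y, (l ^ 5 * R n (scl l y)) * η (z - y) =
        ∫ y, (l ^ 5 * R n (scl l y)) * (η (z - y) - η z) := by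
      simp_rw [mul_sub]
      rw [integral_sub, integral_mul_const, h0, zero_mul, sub_zero]
      · exact (hFc.mul (hη.continuous.comp (by fun_prop))).integrable_of_hasCompactSupport
          hFs.mul_right
      · exact (hFc.mul continuous_const).integrable_of_hasCompactSupport hFs.mul_right
    rw [heq]
    refine (abs_integral_mul_le_of_snorm4_le (D := L * (C₁ ^ 2 / (2 ^ n * l))) (by positivity) hs
      (hpt l hl.1 n) fun y hy => ?_).trans (le_of_eq ?_)
    · have h1 := hL.dist_le_mul (z - y) z
      rw [Real.dist_eq, dist_eq_norm, sub_sub_cancel_left, norm_neg] at h1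
      exact h1.trans (by gcongr; exact norm_le_of_snorm4_le_div hC₁ hn.le hy)
    · have hβ' : (2 ^ n * l) ^ (-β) = 1 := by simp [← hβ]
      have h1 := hscale (2 ^ n * l) (c * l ^ β * (L * (C₁ ^ 2 / (2 ^ n * l)))) ht
      rw [hβ'] at h1
      rw [Real.rpow_neg_one]
      linear_combination h1
  · obtain ⟨D, hD⟩ := hηs.exists_bound_of_continuous hη.continuous
    have hD0 : 0 ≤ D := (norm_nonneg _).trans (hD 0)
    refine ⟨β, hβ, c * (16 * C₁ ^ 5) * D, by positivity, fun l hl n hn z => ?_⟩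
    have hl0 := hl.1
    have ht : 0 < 2 ^ n * l := by positivity
    refine (abs_integral_mul_le_of_snorm4_le (D := D) (by positivity)
      (snorm4_le_of_rescale_ne_zero hl.1 (hsupp n)) (hpt l hl.1 n) fun y _ => hD _).trans
      (le_of_eq ?_)
    linear_combination hscale (2 ^ n * l) (c * l ^ β * D) ht

/-- Rescaled kernels above unit scale: the vanishing moments of the test function give decay. -/
theorem AssumptionR.exists_bound_large_scale {R : ℕ → (Fin 4 → ℝ) → ℝ} {β : ℝ}
    (hR : AssumptionR R β) {η : (Fin 4 → ℝ) → ℝ} (hη : Continuous η)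
    (hηs : HasCompactSupport η) {q : ℝ}
    (hmom : ∀ k : Fin 4 → ℕ, ksize k < q → (∫ y, (∏ i, y i ^ k i) * η y) = 0) :
    ∃ A ≥ 0, ∀ l > 0, ∀ (n : ℕ), 2 ^ n * l ≤ 1 → ∀ z : Fin 4 → ℝ,
      |∫ y, (l ^ 5 * R n (scl l y)) * η (z - y)| ≤ A * l ^ β * (2 ^ n * l) ^ (5 + q - β) := by
  obtain ⟨T, hT, C, hC, h⟩ := exists_bound_integral_of_moments _ q (Nat.le_ceil q) η hη hηs hmom
  obtain ⟨C₀, -, hsupp⟩ := hR.support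
  choose c hc0 hc using hR.deriv_bound
  refine ⟨C * ∑ k ∈ T, c k, mul_nonneg hC (Finset.sum_nonneg fun k _ => (hc0 k).le),
    fun l hl n hn z => ?_⟩
  have ht : 0 < 2 ^ n * l := by positivity
  have key := h (fun y => l ^ 5 * R n (scl l y)) (contDiff_mul_comp_scl (hR.smooth n) _ l)
    (hasCompactSupport_of_snorm4_le (snorm4_le_of_rescale_ne_zero hl (hsupp n)))
    ((∑ k ∈ T, c k) * l ^ β * (2 ^ n * l) ^ (5 + q - β)) (fun k hk y => ?_) 1
    ⟨zero_le_one, le_rfl⟩ z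
  · rw [← integral_sub_left_eq_self _ volume z]
    simp only [one_smul, sub_sub_cancel] at key ⊢
    exact key.trans (le_of_eq (by ring))
  · refine (abs_pderivM_rescale_le (hR.smooth n) hl n k (hc k n) y).trans ?_
    have h1 : c k ≤ ∑ k ∈ T, c k := Finset.single_le_sum (fun k _ => (hc0 k).le) hk
    have h2 : (2 ^ n * l) ^ (5 + ksize k - β) ≤ (2 ^ n * l) ^ (5 + q - β) :=
      Real.rpow_le_rpow_of_exponent_ge ht hn (by linarith [hT k hk])
    have := (hc0 k).le.trans h1
    gcongr

theorem AssumptionR.exists_term_bound {R : ℕ → (Fin 4 → ℝ) → ℝ} {β : ℝ}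
    (hR : AssumptionR R β) {η : (Fin 4 → ℝ) → ℝ} (hη : ContDiff ℝ (⊤ : ℕ∞) η)
    (hηs : HasCompactSupport η) {q : ℝ} (hq : β - 5 < q)
    (hmom : ∀ k : Fin 4 → ℕ, ksize k < q → (∫ y, (∏ i, y i ^ k i) * η y) = 0) :
    ∃ δ : ℝ, 0 < δ ∧ ∃ K > 0, ∃ A ≥ 0, ∀ l ∈ Set.Ioc (0 : ℝ) 1, ∀ z : Fin 4 → ℝ, ∀ n : ℕ,
      |∫ y, (l ^ 5 * R n (scl l y)) * η (z - y)| ≤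
        A * l ^ β * (K / (1 + snorm4 z)) ^ (5 + q - β) *
          (min (2 ^ n * l) (2 ^ n * l)⁻¹ ^ δ +
            min (2 ^ n * (l / (K / (1 + snorm4 z)))) (2 ^ n * (l / (K / (1 + snorm4 z))))⁻¹ ^
              (5 + q - β)) := by
  obtain ⟨C₀, hC₀, hsupp⟩ := hR.support
  obtain ⟨K₁, hK₁, hηK⟩ := exists_snorm4_le_of_hasCompactSupport hηs
  obtain ⟨δ, hδ, A₁, hA₁, hsmall⟩ := hR.exists_bound_small_scale hη hηs
  obtain ⟨A₂, hA₂, hlarge⟩ := hR.exists_bound_large_scale hη.continuous hηs hmom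
  refine ⟨δ, hδ, 1 + C₀ + K₁, by positivity, A₁ + A₂, by positivity, fun l hl z n => ?_⟩
  have hl0 := hl.1
  have hz := snorm4_nonneg z
  set W := (1 + C₀ + K₁) / (1 + snorm4 z) with hW
  have hW0 : 0 < W := by positivity
  have ht : 0 < 2 ^ n * l := by positivity
  by_cases h0 : ∫ y, (l ^ 5 * R n (scl l y)) * η (z - y) = 0
  · rw [h0, abs_zero]
    positivity
  obtain ⟨y, hy⟩ : ∃ y, (l ^ 5 * R n (scl l y)) * η (z - y) ≠ 0 := by
    by_contra! h
    exact h0 (by simp [h])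
  have hzle : snorm4 z ≤ C₀ / (2 ^ n * l) + K₁ := by
    have h := snorm4_add_le y (z - y)
    rw [add_sub_cancel] at h
    exact h.trans (add_le_add (snorm4_le_of_rescale_ne_zero hl.1 (hsupp n) y
      (left_ne_zero_of_mul hy)) (hηK _ (right_ne_zero_of_mul hy)))
  rcases le_or_gt (2 ^ n * l) 1 with h | h
  · have htW : 2 ^ n * l ≤ W := by
      rw [hW, le_div_iff₀ (by positivity)]
      have h1 := mul_le_mul_of_nonneg_left hzle ht.le
      rw [mul_add, mul_div_cancel₀ _ ht.ne'] at h1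
      nlinarith
    have hu : 2 ^ n * (l / W) ≤ 1 := by
      rw [← mul_div_assoc]
      exact (div_le_one hW0).2 htW
    have hu0 : 0 < 2 ^ n * (l / W) := by positivity
    rw [min_eq_left (hu.trans ((one_le_inv₀ hu0).2 hu))]
    calc _ ≤ A₂ * l ^ β * (2 ^ n * l) ^ (5 + q - β) := hlarge l hl.1 n h z
      _ = A₂ * l ^ β * W ^ (5 + q - β) * (2 ^ n * (l / W)) ^ (5 + q - β) := by
        rw [mul_assoc _ (W ^ _), ← Real.mul_rpow hW0.le hu0.le]
        congr 2
        field_simp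
      _ ≤ _ := by
        gcongr
        · linarith
        · exact le_add_of_nonneg_left (by positivity)
  · have hW1 : 1 ≤ W := by
      rw [hW, le_div_iff₀ (by positivity)]
      linarith [div_le_self hC₀.le h.le]
    rw [min_eq_right ((inv_le_one_of_one_le₀ h.le).trans h.le)]
    calc _ ≤ A₁ * l ^ β * (2 ^ n * l) ^ (-δ) := hsmall l hl n h z
      _ = A₁ * l ^ β * 1 * (2 ^ n * l)⁻¹ ^ δ := by
        rw [Real.rpow_neg ht.le, Real.inv_rpow ht.le, mul_one]
      _ ≤ _ := by
        gcongr
        · linarith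
        · exact Real.one_le_rpow hW1 (by linarith)
        · exact le_add_of_nonneg_right (by positivity)

/-- Lemma 5.5 of the paper.  Under Assumption R, if η is smooth, compactly
supported, with vanishing moments up to order q > β - |s|, then for all λ ∈ (0,1] and z,
|∑ₙ (Rₙ^(λ⁻¹) * η)(z)| ≤ C λ^β (1+|z|_s)^(-|s|-q+β), where Rₙ^(λ⁻¹)(y) = λ^(|s|) Rₙ(λ·y). -/
theorem stmt6 (R : ℕ → (Fin 4 → ℝ) → ℝ) (β : ℝ) (hR : AssumptionR R β)
    (η : (Fin 4 → ℝ) → ℝ) (hηsmooth : ContDiff ℝ (⊤ : ℕ∞) η)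
    (hηsupp : HasCompactSupport η)
    (q : ℝ) (hq : β - 5 < q)
    (hmom : ∀ k : Fin 4 → ℕ, ksize k < q → (∫ y, (∏ i, y i ^ k i) * η y) = 0) :
    ∃ C > 0, ∀ l ∈ Set.Ioc (0 : ℝ) 1, ∀ z : Fin 4 → ℝ,
      |∑' n : ℕ, ∫ y : Fin 4 → ℝ, (l ^ (5 : ℕ) * R n (scl l y)) * η (z - y)| ≤
        C * l ^ β * (1 + snorm4 z) ^ (-(5 : ℝ) - q + β) := by
  obtain ⟨δ, hδ, K, hK, A, hA, hterm⟩ := hR.exists_term_bound hηsmooth hηsupp hq hmom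
  obtain ⟨S₁, hS₁⟩ := exists_tsum_min_rpow_le hδ
  obtain ⟨S₂, hS₂⟩ := exists_tsum_min_rpow_le (show 0 < 5 + q - β by linarith)
  refine ⟨A * K ^ (5 + q - β) * (|S₁| + |S₂|) + 1, by positivity, fun l hl z => ?_⟩
  have hl0 := hl.1
  have hz := snorm4_nonneg z
  obtain ⟨hs₁, hle₁⟩ := hS₁ l hl.1
  obtain ⟨hs₂, hle₂⟩ := hS₂ (l / (K / (1 + snorm4 z))) (by positivity)
  have hsum := (hs₁.hasSum.add hs₂.hasSum).mul_left
    (A * l ^ β * (K / (1 + snorm4 z)) ^ (5 + q - β))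
  rw [← Real.norm_eq_abs]
  refine (tsum_of_norm_bounded hsum fun n =>
    (Real.norm_eq_abs _).trans_le (hterm l hl z n)).trans ?_
  have hexp : (K / (1 + snorm4 z)) ^ (5 + q - β) =
      K ^ (5 + q - β) * (1 + snorm4 z) ^ (-(5 : ℝ) - q + β) := by
    rw [Real.div_rpow hK.le (by positivity), div_eq_mul_inv, ← Real.rpow_neg (by positivity)]
    congr 2
    ring
  calc _ ≤ A * l ^ β * (K / (1 + snorm4 z)) ^ (5 + q - β) * (|S₁| + |S₂|) := by
        gcongr
        · exact hle₁.trans (le_abs_self _)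
        · exact hle₂.trans (le_abs_self _)
    _ = A * K ^ (5 + q - β) * (|S₁| + |S₂|) * l ^ β *
        (1 + snorm4 z) ^ (-(5 : ℝ) - q + β) := by rw [hexp]; ring
    _ ≤ _ := by
        gcongr
        linarith
end
end
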